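/- arXiv:1101.3967 — 3 statements merged into one kernel-verified Lean document; each statement's English description precedes it below -/
import Mathlib

section
/- Let n ≥ 1 and 0 < p < ∞. There exist constants C, C' > 0 depending only on n and p such that for all α, β > 0 and every locally square integrable function g on (0,∞)×ℝⁿ: C · min((α/β)^{-n/2}, (α/β)^{-n/p}) · ‖g‖_{T^{p,2}_α} ≤ ‖g‖_{T^{p,2}_β} ≤ C' · max((α/β)^{-n/2}, (α/β)^{-n/p}) · ‖g‖_{T^{p,2}_α}. -/
open MeasureTheory Metric Set Filter ENNReal

noncomputable section

/-- `ℝⁿ` as a Euclidean space. -/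
abbrev En (n : ℕ) : Type := EuclideanSpace ℝ (Fin n)

/-- `g` is (measurable and) locally square integrable on `(0,∞) × ℝⁿ`. -/
def LocSqInt (n : ℕ) (g : ℝ → En n → ℝ) : Prop :=
  Measurable (Function.uncurry g) ∧
  LocallyIntegrableOn (fun q : ℝ × En n => (g q.1 q.2) ^ 2)
    (Set.Ioi (0 : ℝ) ×ˢ (Set.univ : Set (En n)))

/-- The conical square function `A^{(α)} g (x)` of aperture `α`, with values in `[0,∞]`. -/
def conicalSq (n : ℕ) (α : ℝ) (g : ℝ → En n → ℝ) (x : En n) : ℝ≥0∞ :=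
  (∫⁻ t in Set.Ioi (0 : ℝ), ∫⁻ y,
      (ball x (α * t)).indicator (fun y => ENNReal.ofReal (|g t y| ^ 2 / t ^ (n + 1))) y) ^
    (1 / 2 : ℝ)

/-- The tent space quasi-norm `‖g‖_{T^{p,2}_α} = ‖A^{(α)} g‖_{L^p(ℝⁿ)}`, with values in `[0,∞]`. -/
def tentNorm (n : ℕ) (p α : ℝ) (g : ℝ → En n → ℝ) : ℝ≥0∞ :=
  (∫⁻ x, conicalSq n α g x ^ p) ^ (1 / p)

/-- The vertical square function `V g (x)`. -/
def vertSq (n : ℕ) (g : ℝ → En n → ℝ) (x : En n) : ℝ≥0∞ :=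
  (∫⁻ t in Set.Ioi (0 : ℝ), ENNReal.ofReal (|g t x| ^ 2 / t)) ^ (1 / 2 : ℝ)

/-- `‖V g‖_{L^p(ℝⁿ)}`, with values in `[0,∞]`. -/
def vertNorm (n : ℕ) (p : ℝ) (g : ℝ → En n → ℝ) : ℝ≥0∞ :=
  (∫⁻ x, vertSq n g x ^ p) ^ (1 / p)

/-- The tent `T_α B` of aperture `α` above the ball `B = B(x,r)`. -/
def tent (n : ℕ) (α : ℝ) (x : En n) (r : ℝ) : Set (ℝ × En n) :=
  {q | 0 < q.1 ∧ q.1 < r / α ∧ q.2 ∈ ball x (r - α * q.1)}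

/-- `∫_{T_α B} |g(t,y)|² dy dt / t`. -/
def tentIntegral (n : ℕ) (α : ℝ) (g : ℝ → En n → ℝ) (x : En n) (r : ℝ) : ℝ≥0∞ :=
  ∫⁻ q in tent n α x r, ENNReal.ofReal (|g q.1 q.2| ^ 2 / q.1)

/-- A `T^{p,2}_α`-atom associated with the ball `B(x,r)`: it is supported in the tent
`T_α B(x,r)` and satisfies `∫_{T_α B} |a|² dy dt/t ≤ α^{-n} |B|^{-(2/p - 1)}`. -/
def IsTentAtom (n : ℕ) (p α : ℝ) (a : ℝ → En n → ℝ) (x : En n) (r : ℝ) : Prop :=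
  (∀ t y, (t, y) ∉ tent n α x r → a t y = 0) ∧
  tentIntegral n α a x r ≤
    ENNReal.ofReal (α ^ (-(n : ℝ))) * volume (ball x r) ^ (-(2 / p - 1))

/-- The grand square function `G_λ g (x)` with exponent `nλ`. -/
def grandSq (n : ℕ) (l : ℝ) (g : ℝ → En n → ℝ) (x : En n) : ℝ≥0∞ :=
  (∫⁻ t in Set.Ioi (0 : ℝ), ∫⁻ y,
      ENNReal.ofReal ((t / (dist x y + t)) ^ ((n : ℝ) * l) * |g t y| ^ 2 / t ^ (n + 1))) ^
    (1 / 2 : ℝ)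

/-! ### Layer-cake formulas for `ℝ≥0∞`-valued functions -/

theorem lintegral_indicator_lt_rpow (a : ℝ≥0∞) {c : ℝ} (hc : 0 < c) :
    ∫⁻ s in Ioi (0 : ℝ), {s : ℝ | ENNReal.ofReal s < a}.indicator
      (fun s => ENNReal.ofReal (s ^ (c - 1))) s = a ^ c / ENNReal.ofReal c := by
  induction a with
  | top =>
    have h1 : {s : ℝ | ENNReal.ofReal s < ⊤} = univ := by ext; simp
    rw [h1, indicator_univ, ENNReal.top_rpow_of_pos hc, ENNReal.top_div_of_ne_top ofReal_ne_top]
    by_contra h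
    refine not_integrableOn_Ioi_rpow (c - 1) ⟨by fun_prop, ?_⟩
    rw [hasFiniteIntegral_iff_ofReal]
    · exact lt_top_iff_ne_top.2 h
    · filter_upwards [self_mem_ae_restrict measurableSet_Ioi] with s hs
      exact Real.rpow_nonneg (le_of_lt hs) _
  | coe b =>
    have h1 : ∀ s ∈ Ioi (0 : ℝ), {s : ℝ | ENNReal.ofReal s < b}.indicator
        (fun s => ENNReal.ofReal (s ^ (c - 1))) s =
        (Iio (b : ℝ)).indicator (fun s => ENNReal.ofReal (s ^ (c - 1))) s := by
      intro s hs
      have : ENNReal.ofReal s < b ↔ s < b := by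
        rw [← ENNReal.ofReal_coe_nnreal, ENNReal.ofReal_lt_ofReal_iff_of_nonneg (le_of_lt hs)]
      simp only [indicator, mem_ofPred_eq, this, mem_Iio]
    rw [setLIntegral_congr_fun measurableSet_Ioi h1, setLIntegral_indicator measurableSet_Iio,
      Iio_inter_Ioi, restrict_Ioo_eq_restrict_Ioc,
      ← ofReal_integral_eq_lintegral_ofReal,
      ← intervalIntegral.integral_of_le b.coe_nonneg,
      integral_rpow (Or.inl (by linarith))]
    · rw [sub_add_cancel, Real.zero_rpow hc.ne', sub_zero, ENNReal.ofReal_div_of_pos hc,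
        ← ENNReal.ofReal_rpow_of_nonneg b.coe_nonneg hc.le, ENNReal.ofReal_coe_nnreal]
    · exact (intervalIntegrable_iff_integrableOn_Ioc_of_le b.coe_nonneg).1
        (intervalIntegral.intervalIntegrable_rpow' (by linarith))
    · filter_upwards [self_mem_ae_restrict measurableSet_Ioc] with s hs
      exact Real.rpow_nonneg (le_of_lt hs.1) _

theorem mul_lintegral_indicator_le_rpow (a : ℝ≥0∞) {r : ℝ} (hr : 0 < r) (hr1 : r < 1) :
    a * ∫⁻ s in Ioi (0 : ℝ), {s : ℝ | a ≤ ENNReal.ofReal s}.indicator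
      (fun s => ENNReal.ofReal (s ^ (r - 2))) s ≤ a ^ r / ENNReal.ofReal (1 - r) := by
  induction a with
  | top => simp [ENNReal.top_rpow_of_pos hr, ENNReal.top_div_of_ne_top ofReal_ne_top]
  | coe b =>
    rcases eq_or_ne b 0 with rfl | hb
    · simp
    have hb : (0 : ℝ) < b := by positivity
    have h1 : ∀ s ∈ Ioi (0 : ℝ), {s : ℝ | b ≤ ENNReal.ofReal s}.indicator
        (fun s => ENNReal.ofReal (s ^ (r - 2))) s =
        (Ici (b : ℝ)).indicator (fun s => ENNReal.ofReal (s ^ (r - 2))) s := by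
      intro s hs
      have : b ≤ ENNReal.ofReal s ↔ b ≤ s := by
        rw [← ENNReal.ofReal_coe_nnreal, ENNReal.ofReal_le_ofReal_iff (le_of_lt hs)]
      simp only [indicator, mem_ofPred_eq, this, mem_Ici]
    have h2 : Ici (b : ℝ) ∩ Ioi 0 = Ici (b : ℝ) :=
      inter_eq_left.2 fun s hs => lt_of_lt_of_le hb hs
    rw [setLIntegral_congr_fun measurableSet_Ioi h1, setLIntegral_indicator measurableSet_Ici,
      h2, ← restrict_Ioi_eq_restrict_Ici,
      ← ofReal_integral_eq_lintegral_ofReal, integral_Ioi_rpow_of_lt (by linarith) hb]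
    · rw [← ENNReal.ofReal_coe_nnreal, ← ENNReal.ofReal_mul b.coe_nonneg,
        ENNReal.ofReal_rpow_of_pos hb, ← ENNReal.ofReal_div_of_pos (by linarith)]
      refine ENNReal.ofReal_le_ofReal (le_of_eq ?_)
      have e : (b : ℝ) ^ r = b * b ^ (r - 2 + 1) := by
        rw [← Real.rpow_one_add' hb.le (by linarith)]; congr 1; ring
      rw [e]
      have : r - 2 + 1 ≠ 0 := by linarith
      have : 1 - r ≠ 0 := by linarith
      field_simp
      ring
    · exact integrableOn_Ioi_rpow_of_lt (by linarith) hb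
    · filter_upwards [self_mem_ae_restrict measurableSet_Ioi] with s hs
      exact Real.rpow_nonneg (hb.trans hs).le _

section Interpolation

variable {X : Type*} [MeasurableSpace X] {μ : Measure X} [SFinite μ]

theorem lintegral_mul_setLIntegral_swap {R : ℝ → Set X}
    (hR : MeasurableSet {q : ℝ × X | q.2 ∈ R q.1}) {φ : ℝ → ℝ≥0∞} (hφ : Measurable φ)
    {v : X → ℝ≥0∞} (hv : Measurable v) (ν : Measure ℝ) [SFinite ν] :
    ∫⁻ s, φ s * ∫⁻ x in R s, v x ∂μ ∂ν =
      ∫⁻ x, v x * ∫⁻ s, {s | x ∈ R s}.indicator φ s ∂ν ∂μ := by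
  have hRs : ∀ s, MeasurableSet (R s) := fun s => measurable_prodMk_left hR
  have hRx : ∀ x, MeasurableSet {s | x ∈ R s} := fun x => measurable_prodMk_right hR
  have h1 : ∀ s, φ s * ∫⁻ x in R s, v x ∂μ = ∫⁻ x,
      {q : ℝ × X | q.2 ∈ R q.1}.indicator (fun q => φ q.1 * v q.2) (s, x) ∂μ := by
    intro s
    rw [← lintegral_const_mul _ hv, ← lintegral_indicator (hRs s)]
    rfl
  have h2 : ∀ x, v x * ∫⁻ s, {s | x ∈ R s}.indicator φ s ∂ν = ∫⁻ s,
      {q : ℝ × X | q.2 ∈ R q.1}.indicator (fun q => φ q.1 * v q.2) (s, x) ∂ν := by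
    intro x
    rw [lintegral_indicator (hRx x), ← lintegral_const_mul _ hφ, ← lintegral_indicator (hRx x)]
    refine lintegral_congr fun s => ?_
    simp only [indicator, mem_ofPred_eq, mul_comm (v x)]
  simp_rw [h1, h2]
  refine lintegral_lintegral_swap ?_
  exact (((hφ.comp measurable_fst).mul (hv.comp measurable_snd)).indicator hR).aemeasurable

theorem measurable_setLIntegral_section {R : ℝ → Set X}
    (hR : MeasurableSet {q : ℝ × X | q.2 ∈ R q.1}) {v : X → ℝ≥0∞} (hv : Measurable v) :
    Measurable fun s => ∫⁻ x in R s, v x ∂μ := by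
  have : ∀ s, ∫⁻ x in R s, v x ∂μ = ∫⁻ x,
      {q : ℝ × X | q.2 ∈ R q.1}.indicator (fun q => v q.2) (s, x) ∂μ := by
    intro s
    rw [← lintegral_indicator (show MeasurableSet (R s) from measurable_prodMk_left hR)]
    rfl
  simp_rw [this]
  exact ((hv.comp measurable_snd).indicator hR).lintegral_prod_right'

theorem measurableSet_ofReal_lt {f : X → ℝ≥0∞} (hf : Measurable f) :
    MeasurableSet {q : ℝ × X | ENNReal.ofReal q.1 < f q.2} :=
  measurableSet_lt (by fun_prop) (by fun_prop)

theorem lintegral_rpow_eq_layercake {f : X → ℝ≥0∞} (hf : Measurable f) {c : ℝ} (hc : 0 < c) :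
    ∫⁻ x, f x ^ c ∂μ = ENNReal.ofReal c *
      ∫⁻ s in Ioi (0 : ℝ), ENNReal.ofReal (s ^ (c - 1)) * μ {x | ENNReal.ofReal s < f x} := by
  have := lintegral_mul_setLIntegral_swap (μ := μ) (R := fun s => {x | ENNReal.ofReal s < f x})
    (measurableSet_ofReal_lt hf) (φ := fun s => ENNReal.ofReal (s ^ (c - 1))) (by fun_prop)
    (v := fun _ => 1) measurable_const (volume.restrict (Ioi (0 : ℝ)))
  simp only [lintegral_one, Measure.restrict_apply_univ, mem_ofPred_eq, one_mul] at this
  rw [this, lintegral_congr fun x => lintegral_indicator_lt_rpow (f x) hc]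
  rw [← lintegral_const_mul _ (by fun_prop)]
  refine lintegral_congr fun x => ?_
  rw [ENNReal.mul_div_cancel (by simpa using hc) ofReal_ne_top]

/-- Interpolation below the exponent `1`. -/
theorem lintegral_rpow_le_of_weak_below {f u : X → ℝ≥0∞} (hf : Measurable f) (hu : Measurable u)
    {a b : ℝ≥0∞} {r : ℝ} (hr : 0 < r) (hr1 : r < 1)
    (h : ∀ s : ℝ, 0 < s → μ {x | ENNReal.ofReal s < f x} ≤
      a * μ {x | ENNReal.ofReal s < u x} +
        b * (ENNReal.ofReal s⁻¹ * ∫⁻ x in {x | u x ≤ ENNReal.ofReal s}, u x ∂μ)) :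
    ∫⁻ x, f x ^ r ∂μ ≤ (a + b * ENNReal.ofReal (r / (1 - r))) * ∫⁻ x, u x ^ r ∂μ := by
  have hR : MeasurableSet {q : ℝ × X | u q.2 ≤ ENNReal.ofReal q.1} :=
    measurableSet_le (by fun_prop) (by fun_prop)
  have hm := lintegral_mul_setLIntegral_swap (μ := μ) (R := fun s => {x | u x ≤ ENNReal.ofReal s})
    hR (φ := fun s => ENNReal.ofReal (s ^ (r - 2))) (by fun_prop) hu (volume.restrict (Ioi (0 : ℝ)))
  calc ∫⁻ x, f x ^ r ∂μ = ENNReal.ofReal r * ∫⁻ s in Ioi (0 : ℝ),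
        ENNReal.ofReal (s ^ (r - 1)) * μ {x | ENNReal.ofReal s < f x} :=
        lintegral_rpow_eq_layercake hf hr
    _ ≤ ENNReal.ofReal r * ∫⁻ s in Ioi (0 : ℝ),
        (a * (ENNReal.ofReal (s ^ (r - 1)) * μ {x | ENNReal.ofReal s < u x}) +
        b * (ENNReal.ofReal (s ^ (r - 2)) * ∫⁻ x in {x | u x ≤ ENNReal.ofReal s}, u x ∂μ)) := by
      refine mul_le_mul' le_rfl (setLIntegral_mono' measurableSet_Ioi fun s hs => ?_)
      have e : ENNReal.ofReal (s ^ (r - 2)) =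
          ENNReal.ofReal (s ^ (r - 1)) * ENNReal.ofReal s⁻¹ := by
        rw [← ENNReal.ofReal_mul (Real.rpow_nonneg (le_of_lt hs) _), ← Real.rpow_neg_one,
          ← Real.rpow_add hs]
        congr 2; ring
      rw [e]
      calc _ ≤ _ := mul_le_mul' le_rfl (h s hs)
        _ = _ := by ring
    _ = a * (ENNReal.ofReal r * ∫⁻ s in Ioi (0 : ℝ),
          ENNReal.ofReal (s ^ (r - 1)) * μ {x | ENNReal.ofReal s < u x}) +
        b * (ENNReal.ofReal r * ∫⁻ s in Ioi (0 : ℝ), ENNReal.ofReal (s ^ (r - 2)) *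
          ∫⁻ x in {x | u x ≤ ENNReal.ofReal s}, u x ∂μ) := by
      have m1 : Measurable fun s : ℝ =>
          ENNReal.ofReal (s ^ (r - 1)) * μ {x | ENNReal.ofReal s < u x} :=
        Measurable.mul (by fun_prop) (measurable_measure_prodMk_left (measurableSet_ofReal_lt hu))
      rw [lintegral_add_left (m1.const_mul a), lintegral_const_mul _ m1]
      have m2 : Measurable fun s : ℝ => ENNReal.ofReal (s ^ (r - 2)) *
          ∫⁻ x in {x | u x ≤ ENNReal.ofReal s}, u x ∂μ := by
        exact Measurable.mul (by fun_prop)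
          (measurable_setLIntegral_section (R := fun s => {x | u x ≤ ENNReal.ofReal s}) hR hu)
      rw [lintegral_const_mul _ m2]
      ring
    _ ≤ a * ∫⁻ x, u x ^ r ∂μ +
        b * (ENNReal.ofReal r * ∫⁻ x, u x ^ r / ENNReal.ofReal (1 - r) ∂μ) := by
      rw [← lintegral_rpow_eq_layercake hu hr, hm]
      gcongr with x
      exact mul_lintegral_indicator_le_rpow (u x) hr hr1
    _ = _ := by
      rw [ENNReal.ofReal_div_of_pos (by linarith)]
      simp_rw [div_eq_mul_inv]
      rw [lintegral_mul_const _ (by fun_prop)]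
      ring

/-- Interpolation above the exponent `1`. -/
theorem lintegral_rpow_le_of_weak_above {f u : X → ℝ≥0∞} (hf : Measurable f) (hu : Measurable u)
    {a : ℝ≥0∞} {q : ℝ} (hq : 1 < q)
    (h : ∀ s : ℝ, 0 < s → μ {x | ENNReal.ofReal s < f x} ≤
      a * (ENNReal.ofReal s⁻¹ * ∫⁻ x in {x | ENNReal.ofReal s < 2 * u x}, u x ∂μ)) :
    ∫⁻ x, f x ^ q ∂μ ≤
      a * ENNReal.ofReal (2 ^ (q - 1) * (q / (q - 1))) * ∫⁻ x, u x ^ q ∂μ := by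
  have h2u : Measurable fun x => 2 * u x := by fun_prop
  have hm := lintegral_mul_setLIntegral_swap (μ := μ) (R := fun s => {x | ENNReal.ofReal s < 2 * u x})
    (measurableSet_ofReal_lt h2u) (φ := fun s => ENNReal.ofReal (s ^ (q - 1 - 1))) (by fun_prop) hu
    (volume.restrict (Ioi (0 : ℝ)))
  calc ∫⁻ x, f x ^ q ∂μ = ENNReal.ofReal q * ∫⁻ s in Ioi (0 : ℝ),
        ENNReal.ofReal (s ^ (q - 1)) * μ {x | ENNReal.ofReal s < f x} :=
        lintegral_rpow_eq_layercake hf (by linarith)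
    _ ≤ ENNReal.ofReal q * ∫⁻ s in Ioi (0 : ℝ),
        a * (ENNReal.ofReal (s ^ (q - 1 - 1)) *
          ∫⁻ x in {x | ENNReal.ofReal s < 2 * u x}, u x ∂μ) := by
      refine mul_le_mul' le_rfl (setLIntegral_mono' measurableSet_Ioi fun s hs => ?_)
      have e : ENNReal.ofReal (s ^ (q - 1 - 1)) =
          ENNReal.ofReal (s ^ (q - 1)) * ENNReal.ofReal s⁻¹ := by
        rw [← ENNReal.ofReal_mul (Real.rpow_nonneg (le_of_lt hs) _), ← Real.rpow_neg_one,
          ← Real.rpow_add hs]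
        congr 2
      rw [e]
      calc _ ≤ _ := mul_le_mul' le_rfl (h s hs)
        _ = _ := by ring
    _ = a * (ENNReal.ofReal q * ∫⁻ s in Ioi (0 : ℝ), ENNReal.ofReal (s ^ (q - 1 - 1)) *
          ∫⁻ x in {x | ENNReal.ofReal s < 2 * u x}, u x ∂μ) := by
      have m2 : Measurable fun s : ℝ => ENNReal.ofReal (s ^ (q - 1 - 1)) *
          ∫⁻ x in {x | ENNReal.ofReal s < 2 * u x}, u x ∂μ := by
        exact Measurable.mul (by fun_prop)
          (measurable_setLIntegral_section (R := fun s => {x | ENNReal.ofReal s < 2 * u x})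
            (measurableSet_ofReal_lt h2u) hu)
      rw [lintegral_const_mul _ m2]
      ring
    _ = a * (ENNReal.ofReal q * ∫⁻ x,
          ENNReal.ofReal (2 ^ (q - 1)) / ENNReal.ofReal (q - 1) * u x ^ q ∂μ) := by
      rw [hm]
      congr 2
      refine lintegral_congr fun x => ?_
      simp only [mem_ofPred_eq]
      rw [lintegral_indicator_lt_rpow (2 * u x) (by linarith : 0 < q - 1),
        ENNReal.mul_rpow_of_nonneg _ _ (by linarith), ← ENNReal.ofReal_rpow_of_pos two_pos,
        ENNReal.ofReal_ofNat, div_eq_mul_inv, div_eq_mul_inv]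
      have e : u x ^ q = u x * u x ^ (q - 1) := by
        conv_lhs => rw [show q = 1 + (q - 1) by ring]
        rw [ENNReal.rpow_add_of_nonneg _ _ (by norm_num) (by linarith), ENNReal.rpow_one]
      rw [e]
      ring
    _ = _ := by
      rw [lintegral_const_mul _ (by fun_prop), ENNReal.ofReal_mul (by positivity),
        ENNReal.ofReal_div_of_pos (by linarith), div_eq_mul_inv, div_eq_mul_inv]
      ring

end Interpolation

/-! ### A maximal function with two apertures -/

theorem volume_ball_mul_eq {n : ℕ} {c d t : ℝ} (hc : 0 < c) (hd : 0 < d) (ht : 0 < t)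
    (y z : En n) : volume (ball y (c * t)) =
      ENNReal.ofReal ((c / d) ^ n) * volume (ball z (d * t)) := by
  have h := Measure.addHaar_ball_mul_of_pos volume y (div_pos hc hd) (d * t)
  rw [show c / d * (d * t) = c * t by field_simp, finrank_euclideanSpace_fin] at h
  rw [h, Measure.addHaar_ball_center volume z]

/-- The supremum of the averages of `h` over the balls `B(y, βt)` with `|x - y| < αt`. -/
def coneMaximal {n : ℕ} (α β : ℝ) (h : En n → ℝ≥0∞) (x : En n) : ℝ≥0∞ :=
  ⨆ (y : En n) (t : ℝ) (_ : 0 < t) (_ : dist x y < α * t),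
    (∫⁻ z in ball y (β * t), h z) / volume (ball y (β * t))

theorem lt_coneMaximal_iff {n : ℕ} {α β : ℝ} {h : En n → ℝ≥0∞} {x : En n} {c : ℝ≥0∞} :
    c < coneMaximal α β h x ↔ ∃ (y : En n) (t : ℝ), 0 < t ∧ dist x y < α * t ∧
      c < (∫⁻ z in ball y (β * t), h z) / volume (ball y (β * t)) := by
  simp only [coneMaximal, lt_iSup_iff, exists_prop]

theorem setLIntegral_ball_le_coneMaximal_mul {n : ℕ} {α β t : ℝ} (hβ : 0 < β) (ht : 0 < t)
    {x y : En n} (hxy : dist x y < α * t) (h : En n → ℝ≥0∞) :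
    ∫⁻ z in ball y (β * t), h z ≤ coneMaximal α β h x * volume (ball y (β * t)) := by
  have h0 : volume (ball y (β * t)) ≠ 0 := (measure_ball_pos _ _ (by positivity)).ne'
  rw [← ENNReal.div_le_iff h0 measure_ball_lt_top.ne]
  exact le_iSup_of_le y (le_iSup_of_le t (le_iSup_of_le ht (le_iSup_of_le hxy le_rfl)))

theorem measurable_coneMaximal {n : ℕ} (α β : ℝ) (h : En n → ℝ≥0∞) :
    Measurable (coneMaximal α β h) := by
  refine measurable_of_Ioi fun c => IsOpen.measurableSet ?_
  refine isOpen_iff_mem_nhds.2 fun x hx => ?_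
  obtain ⟨y, t, ht, hxy, hc⟩ := lt_coneMaximal_iff.1 hx
  filter_upwards [isOpen_ball.mem_nhds (mem_ball.2 hxy)] with z hz
  exact lt_coneMaximal_iff.2 ⟨y, t, ht, hz, hc⟩

theorem mul_volume_lt_coneMaximal_le {n : ℕ} (hn : 1 ≤ n) {α β s : ℝ} (hα : 0 < α) (hβ : 0 < β)
    (hs : 0 < s) (h : En n → ℝ≥0∞) :
    ENNReal.ofReal s * volume {x | ENNReal.ofReal s < coneMaximal α β h x} ≤
      ENNReal.ofReal (((2 * α + 3 * β) / β) ^ n) * ∫⁻ x, h x := by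
  rcases eq_or_ne (∫⁻ x, h x) ⊤ with htop | hfin
  · rw [htop, ENNReal.mul_top]
    · exact le_top
    · simp only [ne_eq, ENNReal.ofReal_eq_zero, not_le]
      positivity
  have : Nontrivial (En n) := by
    have : Nonempty (Fin n) := ⟨⟨0, hn⟩⟩
    infer_instance
  set T : Set (En n × ℝ) := {a | 0 < a.2 ∧
    ENNReal.ofReal s * volume (ball a.1 (β * a.2)) ≤ ∫⁻ z in ball a.1 (β * a.2), h z} with hT
  obtain ⟨R, hR⟩ : ∃ R : ℝ, ∀ a ∈ T, a.2 ≤ R := by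
    set I := (∫⁻ x, h x).toReal
    set V := volume.real (ball (0 : En n) (β * 1))
    have hV : 0 < V := ENNReal.toReal_pos (measure_ball_pos _ _ (by positivity)).ne'
      measure_ball_lt_top.ne
    refine ⟨max 1 (I / (s * V)), fun a ha => ?_⟩
    by_contra hlt
    obtain ⟨h1, h2⟩ := max_lt_iff.1 (not_le.1 hlt)
    have h3 : ENNReal.ofReal s * volume (ball a.1 (β * a.2)) ≤ ∫⁻ x, h x :=
      ha.2.trans (setLIntegral_le_lintegral _ _)
    have h4 : volume (ball a.1 (β * a.2)) =
        ENNReal.ofReal (a.2 ^ n) * volume (ball (0 : En n) (β * 1)) := by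
      have := volume_ball_mul_eq (n := n) ha.1 one_pos hβ a.1 0
      rw [div_one, mul_comm a.2, mul_comm 1] at this
      exact this
    have h5 := ENNReal.toReal_mono hfin h3
    rw [h4, ENNReal.toReal_mul, ENNReal.toReal_mul, ENNReal.toReal_ofReal hs.le,
      ENNReal.toReal_ofReal (by have := ha.1; positivity)] at h5
    have h6 : a.2 ≤ a.2 ^ n := le_self_pow₀ h1.le (by omega)
    rw [div_lt_iff₀ (by positivity)] at h2
    have h7 : s * (a.2 * V) ≤ s * (a.2 ^ n * V) := by gcongr
    have h8 : s * (a.2 ^ n * V) ≤ I := h5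
    nlinarith
  obtain ⟨u, huT, hdisj, hcov⟩ := Vitali.exists_disjoint_subfamily_covering_enlargement
    (fun a : En n × ℝ => ball a.1 (β * a.2)) T (fun a => a.2) 2 one_lt_two
    (fun a ha => ha.1.le) R hR
    (fun a ha => nonempty_ball.2 (mul_pos hβ ha.1))
  have hcount : u.Countable := hdisj.countable_of_isOpen (fun a _ => isOpen_ball)
    (fun a ha => nonempty_ball.2 (mul_pos hβ (huT ha).1))
  have hsub : {x | ENNReal.ofReal s < coneMaximal α β h x} ⊆
      ⋃ b ∈ u, ball b.1 ((2 * α + 3 * β) * b.2) := by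
    intro x hx
    obtain ⟨y, t, ht, hxy, hc⟩ := lt_coneMaximal_iff.1 hx
    have haT : (y, t) ∈ T := by
      refine ⟨ht, ?_⟩
      have h0 : volume (ball y (β * t)) ≠ 0 := (measure_ball_pos _ _ (by positivity)).ne'
      exact (ENNReal.le_div_iff_mul_le (Or.inl h0) (Or.inl measure_ball_lt_top.ne)).1 hc.le
    obtain ⟨b, hb, ⟨z, hz1, hz2⟩, hle⟩ := hcov _ haT
    refine mem_iUnion₂.2 ⟨b, hb, ?_⟩
    have hz1 : dist z y < β * t := hz1
    have hz2 : dist z b.1 < β * b.2 := hz2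
    have hle : t ≤ 2 * b.2 := hle
    have := dist_triangle4 x y z b.1
    rw [dist_comm y z] at this
    rw [mem_ball]
    nlinarith
  calc ENNReal.ofReal s * volume {x | ENNReal.ofReal s < coneMaximal α β h x}
      ≤ ENNReal.ofReal s * ∑' b : u, volume (ball b.1.1 ((2 * α + 3 * β) * b.1.2)) := by
        gcongr
        exact (measure_mono hsub).trans (measure_biUnion_le _ hcount _)
    _ = ∑' b : u, ENNReal.ofReal (((2 * α + 3 * β) / β) ^ n) *
          (ENNReal.ofReal s * volume (ball b.1.1 (β * b.1.2))) := by
        rw [← ENNReal.tsum_mul_left]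
        refine tsum_congr fun b => ?_
        rw [volume_ball_mul_eq (by positivity) hβ (huT b.2).1 b.1.1 b.1.1]
        ring
    _ ≤ ∑' b : u, ENNReal.ofReal (((2 * α + 3 * β) / β) ^ n) *
          ∫⁻ z in ball b.1.1 (β * b.1.2), h z := by
        gcongr with b
        exact (huT b.2).2
    _ ≤ _ := by
        rw [ENNReal.tsum_mul_left, ← lintegral_biUnion hcount (fun _ _ => measurableSet_ball) hdisj]
        exact mul_le_mul' le_rfl (setLIntegral_le_lintegral _ _)

theorem volume_lt_coneMaximal_le {n : ℕ} (hn : 1 ≤ n) {α β s : ℝ} (hα : 0 < α) (hβ : 0 < β)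
    (hs : 0 < s) (h : En n → ℝ≥0∞) :
    volume {x | ENNReal.ofReal s < coneMaximal α β h x} ≤
      ENNReal.ofReal (((2 * α + 3 * β) / β) ^ n) * (ENNReal.ofReal s⁻¹ * ∫⁻ x, h x) := by
  rw [ENNReal.ofReal_inv_of_pos hs, mul_left_comm,
    ← ENNReal.mul_le_iff_le_inv (by simpa using hs) ofReal_ne_top]
  exact mul_volume_lt_coneMaximal_le hn hα hβ hs h

theorem lintegral_coneMaximal_rpow_le {n : ℕ} (hn : 1 ≤ n) {α β q : ℝ} (hα : 0 < α) (hβ : 0 < β)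
    (hq : 1 < q) {h : En n → ℝ≥0∞} (hh : Measurable h) :
    ∫⁻ x, coneMaximal α β h x ^ q ≤ ENNReal.ofReal (((2 * α + 3 * β) / β) ^ n) *
      ENNReal.ofReal (2 ^ q * (q / (q - 1))) * ∫⁻ x, h x ^ q := by
  have key := lintegral_rpow_le_of_weak_above (μ := volume) (measurable_coneMaximal α β h) hh
    (a := 2 * ENNReal.ofReal (((2 * α + 3 * β) / β) ^ n)) hq ?_
  · refine key.trans (le_of_eq ?_)
    rw [show (2 : ℝ) ^ q * (q / (q - 1)) = 2 * (2 ^ (q - 1) * (q / (q - 1))) by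
      rw [Real.rpow_sub_one two_ne_zero]; field_simp, ENNReal.ofReal_mul two_pos.le,
      ENNReal.ofReal_ofNat]
    ring
  intro s hs
  have hm : MeasurableSet {x | ENNReal.ofReal s < 2 * h x} :=
    measurableSet_lt measurable_const (by fun_prop)
  set h' := {x | ENNReal.ofReal s < 2 * h x}.indicator h with hh'
  have hsub : {x | ENNReal.ofReal s < coneMaximal α β h x} ⊆
      {x | ENNReal.ofReal (s / 2) < coneMaximal α β h' x} := by
    intro x hx
    obtain ⟨y, t, ht, hxy, hc⟩ := lt_coneMaximal_iff.1 hx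
    refine lt_coneMaximal_iff.2 ⟨y, t, ht, hxy, ?_⟩
    have h0 : volume (ball y (β * t)) ≠ 0 := (measure_ball_pos _ _ (by positivity)).ne'
    have hf : volume (ball y (β * t)) ≠ ⊤ := measure_ball_lt_top.ne
    by_contra hle
    rw [not_lt, ENNReal.div_le_iff h0 hf] at hle
    rw [ENNReal.lt_div_iff_mul_lt (Or.inl h0) (Or.inl hf)] at hc
    refine hc.not_ge ?_
    have hpt : ∀ z, h z ≤ h' z + ENNReal.ofReal (s / 2) := by
      intro z
      by_cases hz : z ∈ {x | ENNReal.ofReal s < 2 * h x}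
      · rw [hh', indicator_of_mem hz]; exact le_self_add
      · refine le_add_left ?_
        have hz : 2 * h z ≤ ENNReal.ofReal s := not_lt.1 hz
        rw [ENNReal.ofReal_div_of_pos two_pos, ENNReal.ofReal_ofNat,
          ENNReal.le_div_iff_mul_le (by simp) (by simp), mul_comm]
        exact hz
    calc ∫⁻ z in ball y (β * t), h z
        ≤ ∫⁻ z in ball y (β * t), (h' z + ENNReal.ofReal (s / 2)) := lintegral_mono hpt
      _ = (∫⁻ z in ball y (β * t), h' z) + ENNReal.ofReal (s / 2) * volume (ball y (β * t)) := by
        rw [lintegral_add_right _ measurable_const, setLIntegral_const]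
      _ ≤ ENNReal.ofReal (s / 2) * volume (ball y (β * t)) +
          ENNReal.ofReal (s / 2) * volume (ball y (β * t)) := by gcongr
      _ = ENNReal.ofReal s * volume (ball y (β * t)) := by
        rw [← add_mul, ← ENNReal.ofReal_add (by positivity) (by positivity), add_halves]
  calc _ ≤ _ := measure_mono hsub
    _ ≤ _ := volume_lt_coneMaximal_le hn hα hβ (by positivity) h'
    _ = _ := by
      rw [hh', lintegral_indicator hm, inv_div, div_eq_mul_inv 2, ENNReal.ofReal_mul two_pos.le,
        ENNReal.ofReal_ofNat]
      ring

/-! ### Comparison of cone energies -/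

/-- The square of the conical square function. -/
def coneEnergy (n : ℕ) (α : ℝ) (g : ℝ → En n → ℝ) (x : En n) : ℝ≥0∞ :=
  ∫⁻ t in Set.Ioi (0 : ℝ), ∫⁻ y,
    (ball x (α * t)).indicator (fun y => ENNReal.ofReal (|g t y| ^ 2 / t ^ (n + 1))) y

theorem measurable_energyDensity {n : ℕ} {g : ℝ → En n → ℝ} (hg : Measurable (Function.uncurry g)) :
    Measurable fun q : ℝ × En n => ENNReal.ofReal (|g q.1 q.2| ^ 2 / q.1 ^ (n + 1)) := by
  have h : Measurable fun q : ℝ × En n => g q.1 q.2 := hg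
  have h' : Measurable fun q : ℝ × En n => |g q.1 q.2| := measurable_norm.comp h
  fun_prop

theorem measurable_coneIndicator {n : ℕ} (α : ℝ) {g : ℝ → En n → ℝ}
    (hg : Measurable (Function.uncurry g)) :
    Measurable fun z : En n × (ℝ × En n) => (ball z.1 (α * z.2.1)).indicator
      (fun y => ENNReal.ofReal (|g z.2.1 y| ^ 2 / z.2.1 ^ (n + 1))) z.2.2 := by
  have hR : MeasurableSet {z : En n × (ℝ × En n) | dist z.2.2 z.1 < α * z.2.1} :=
    measurableSet_lt (by fun_prop) (by fun_prop)
  exact ((measurable_energyDensity hg).comp measurable_snd).indicator hR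

theorem coneEnergy_eq_lintegral_prod {n : ℕ} (α : ℝ) {g : ℝ → En n → ℝ}
    (hg : Measurable (Function.uncurry g)) (x : En n) :
    coneEnergy n α g x = ∫⁻ q : ℝ × En n, (ball x (α * q.1)).indicator
      (fun y => ENNReal.ofReal (|g q.1 y| ^ 2 / q.1 ^ (n + 1))) q.2
        ∂((volume.restrict (Ioi (0 : ℝ))).prod volume) := by
  rw [lintegral_prod]
  · rfl
  · exact ((measurable_coneIndicator α hg).comp measurable_prodMk_left).aemeasurable

theorem measurable_coneEnergy {n : ℕ} (α : ℝ) {g : ℝ → En n → ℝ}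
    (hg : Measurable (Function.uncurry g)) : Measurable (coneEnergy n α g) := by
  simp_rw [funext (coneEnergy_eq_lintegral_prod α hg)]
  exact (measurable_coneIndicator α hg).lintegral_prod_right'

theorem lintegral_coneEnergy_mul {n : ℕ} (α : ℝ) {g : ℝ → En n → ℝ}
    (hg : Measurable (Function.uncurry g)) {h : En n → ℝ≥0∞} (hh : Measurable h) :
    ∫⁻ x, coneEnergy n α g x * h x = ∫⁻ t in Ioi (0 : ℝ), ∫⁻ y,
      ENNReal.ofReal (|g t y| ^ 2 / t ^ (n + 1)) * ∫⁻ x in ball y (α * t), h x := by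
  have hm : Measurable fun z : En n × (ℝ × En n) => (ball z.1 (α * z.2.1)).indicator
      (fun y => ENNReal.ofReal (|g z.2.1 y| ^ 2 / z.2.1 ^ (n + 1))) z.2.2 * h z.1 :=
    (measurable_coneIndicator α hg).mul (hh.comp measurable_fst)
  have h1 : ∀ x, coneEnergy n α g x * h x = ∫⁻ q : ℝ × En n, (ball x (α * q.1)).indicator
      (fun y => ENNReal.ofReal (|g q.1 y| ^ 2 / q.1 ^ (n + 1))) q.2 * h x
        ∂((volume.restrict (Ioi (0 : ℝ))).prod volume) := by
    intro x
    rw [coneEnergy_eq_lintegral_prod α hg]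
    exact (lintegral_mul_const _
      ((measurable_coneIndicator α hg).comp measurable_prodMk_left)).symm
  have h2 : ∀ q : ℝ × En n, ∫⁻ x, (ball x (α * q.1)).indicator
      (fun y => ENNReal.ofReal (|g q.1 y| ^ 2 / q.1 ^ (n + 1))) q.2 * h x =
      ENNReal.ofReal (|g q.1 q.2| ^ 2 / q.1 ^ (n + 1)) * ∫⁻ x in ball q.2 (α * q.1), h x := by
    intro q
    rw [← lintegral_const_mul _ hh, ← lintegral_indicator measurableSet_ball]
    refine lintegral_congr fun x => ?_
    by_cases hx : x ∈ ball q.2 (α * q.1)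
    · rw [indicator_of_mem hx, indicator_of_mem (mem_ball_comm.1 hx)]
    · rw [indicator_of_notMem hx, indicator_of_notMem (fun h => hx (mem_ball_comm.1 h)), zero_mul]
  simp_rw [h1]
  rw [lintegral_lintegral_swap hm.aemeasurable]
  simp_rw [h2]
  rw [lintegral_prod]
  refine Measurable.aemeasurable ?_
  simp_rw [← h2]
  exact hm.lintegral_prod_left'

theorem lintegral_coneEnergy_mul_le {n : ℕ} {α β : ℝ} {g : ℝ → En n → ℝ}
    (hg : Measurable (Function.uncurry g)) {h k : En n → ℝ≥0∞} (hh : Measurable h)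
    (hk : Measurable k) {K : ℝ≥0∞} (hK : K ≠ ⊤)
    (H : ∀ t : ℝ, 0 < t → ∀ y, ∫⁻ x in ball y (β * t), h x ≤ K * ∫⁻ x in ball y (α * t), k x) :
    ∫⁻ x, coneEnergy n β g x * h x ≤ K * ∫⁻ x, coneEnergy n α g x * k x := by
  rw [lintegral_coneEnergy_mul β hg hh, lintegral_coneEnergy_mul α hg hk,
    ← lintegral_const_mul' _ _ hK]
  refine setLIntegral_mono' measurableSet_Ioi fun t ht => ?_
  rw [← lintegral_const_mul' _ _ hK]
  refine lintegral_mono fun y => ?_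
  rw [mul_left_comm]
  exact mul_le_mul' le_rfl (H t ht y)

theorem lintegral_coneEnergy_le {n : ℕ} {α β : ℝ} (hα : 0 < α) (hβ : 0 < β) {g : ℝ → En n → ℝ}
    (hg : Measurable (Function.uncurry g)) :
    ∫⁻ x, coneEnergy n β g x ≤ ENNReal.ofReal ((β / α) ^ n) * ∫⁻ x, coneEnergy n α g x := by
  have := lintegral_coneEnergy_mul_le (α := α) (β := β) hg (h := fun _ => 1) (k := fun _ => 1)
    measurable_const measurable_const (K := ENNReal.ofReal ((β / α) ^ n)) ofReal_ne_top ?_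
  · simpa using this
  · intro t ht y
    simp only [setLIntegral_one]
    exact (volume_ball_mul_eq hβ hα ht y y).le

theorem lintegral_coneEnergy_mul_le_coneMaximal {n : ℕ} {α β : ℝ} (hα : 0 < α) (hβ : 0 < β)
    {g : ℝ → En n → ℝ} (hg : Measurable (Function.uncurry g)) {h : En n → ℝ≥0∞}
    (hh : Measurable h) :
    ∫⁻ x, coneEnergy n β g x * h x ≤
      ENNReal.ofReal ((β / α) ^ n) * ∫⁻ x, coneEnergy n α g x * coneMaximal α β h x := by
  refine lintegral_coneEnergy_mul_le hg hh (measurable_coneMaximal α β h) ofReal_ne_top ?_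
  intro t ht y
  have h0 : volume (ball y (α * t)) ≠ 0 := (measure_ball_pos _ _ (by positivity)).ne'
  have hf : volume (ball y (α * t)) ≠ ⊤ := measure_ball_lt_top.ne
  rw [← ENNReal.mul_le_mul_iff_right h0 hf]
  calc volume (ball y (α * t)) * ∫⁻ x in ball y (β * t), h x
      = ∫⁻ _ in ball y (α * t), ∫⁻ x in ball y (β * t), h x := by
        rw [setLIntegral_const, mul_comm]
    _ ≤ ∫⁻ x in ball y (α * t), coneMaximal α β h x * volume (ball y (β * t)) :=
        setLIntegral_mono' measurableSet_ball fun x hx =>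
          setLIntegral_ball_le_coneMaximal_mul hβ ht hx h
    _ = _ := by
        rw [lintegral_mul_const _ (measurable_coneMaximal α β h), volume_ball_mul_eq hβ hα ht y y]
        ring

theorem weak_lintegral_coneEnergy_le {n : ℕ} {α β : ℝ} (hα : 0 < α) (hβ : 0 < β)
    {g : ℝ → En n → ℝ} (hg : Measurable (Function.uncurry g)) {O : Set (En n)}
    (hO : MeasurableSet O) :
    ∫⁻ x in {x | coneMaximal β α (O.indicator 1) x ≤ ENNReal.ofReal 2⁻¹}, coneEnergy n β g x ≤
      2 * ENNReal.ofReal ((β / α) ^ n) * ∫⁻ x in Oᶜ, coneEnergy n α g x := by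
  set G := {x | coneMaximal β α (O.indicator 1) x ≤ ENNReal.ofReal 2⁻¹} with hG
  have hGm : MeasurableSet G := measurableSet_le (measurable_coneMaximal _ _ _) measurable_const
  have e : ∀ (γ : ℝ) (A : Set (En n)), MeasurableSet A → ∫⁻ x in A, coneEnergy n γ g x =
      ∫⁻ x, coneEnergy n γ g x * A.indicator 1 x := by
    intro γ A hA
    rw [← lintegral_indicator hA]
    refine lintegral_congr fun x => ?_
    by_cases hx : x ∈ A <;> simp [hx]
  rw [e β G hGm, e α _ hO.compl]
  refine lintegral_coneEnergy_mul_le hg (measurable_one.indicator hGm)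
    (measurable_one.indicator hO.compl) (by finiteness) ?_
  intro t ht y
  rw [lintegral_indicator_one hGm, lintegral_indicator_one hO.compl]
  by_cases hex : ∃ x ∈ G, x ∈ ball y (β * t)
  · obtain ⟨x, hxG, hxy⟩ := hex
    set V := volume (ball y (α * t)) with hV
    have hVf : V ≠ ⊤ := measure_ball_lt_top.ne
    have h1 : (volume.restrict (ball y (α * t))) O ≤ V / 2 := by
      have := setLIntegral_ball_le_coneMaximal_mul hα ht hxy (O.indicator 1)
      rw [lintegral_indicator_one hO] at this
      refine this.trans ((mul_le_mul' hxG le_rfl).trans (le_of_eq ?_))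
      rw [ENNReal.ofReal_inv_of_pos two_pos, ENNReal.ofReal_ofNat, div_eq_mul_inv, mul_comm]
    have h2 : V / 2 ≤ (volume.restrict (ball y (α * t))) Oᶜ := by
      have h3 : V = (volume.restrict (ball y (α * t))) O +
          (volume.restrict (ball y (α * t))) Oᶜ := by
        rw [measure_add_measure_compl hO, Measure.restrict_apply_univ]
      have h4 : V / 2 + V / 2 ≤ V / 2 + (volume.restrict (ball y (α * t))) Oᶜ := by
        rw [ENNReal.add_halves]
        calc V = _ := h3
          _ ≤ _ := by gcongr
      exact (ENNReal.add_le_add_iff_left (ENNReal.div_ne_top hVf two_ne_zero)).1 h4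
    calc (volume.restrict (ball y (β * t))) G ≤ volume (ball y (β * t)) := by
          rw [Measure.restrict_apply hGm]
          exact measure_mono inter_subset_right
      _ = 2 * ENNReal.ofReal ((β / α) ^ n) * (V / 2) := by
          rw [volume_ball_mul_eq hβ hα ht y y, mul_comm 2, mul_assoc,
            ENNReal.mul_div_cancel two_ne_zero ofNat_ne_top]
      _ ≤ _ := by gcongr
  · push Not at hex
    have : (volume.restrict (ball y (β * t))) G = 0 := by
      rw [Measure.restrict_apply hGm, (disjoint_left.2 hex).inter_eq, measure_empty]
    rw [this]
    exact zero_le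

/-- The norm in `L^r` by duality. -/
theorem lintegral_rpow_le_of_dual {X : Type*} [MeasurableSpace X] {μ : Measure X} [SigmaFinite μ]
    {r q : ℝ} (hrq : r.HolderConjugate q) {f : X → ℝ≥0∞} (hf : Measurable f) {A : ℝ≥0∞}
    (H : ∀ h : X → ℝ≥0∞, Measurable h → ∫⁻ x, f x * h x ∂μ ≤ A * (∫⁻ x, h x ^ q ∂μ) ^ (1 / q)) :
    ∫⁻ x, f x ^ r ∂μ ≤ A ^ r := by
  have hr : 1 < r := hrq.lt
  have hr0 : 0 < r := hrq.pos
  have hq0 : 0 < q := hrq.symm.pos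
  set F : ℕ → X → ℝ≥0∞ := fun N => (spanningSets μ N).indicator fun x => min (f x) N with hF
  have hFm : ∀ N, Measurable (F N) := fun N =>
    (hf.min measurable_const).indicator (measurableSet_spanningSets μ N)
  have hFf : ∀ N x, F N x ≤ f x := fun N x =>
    indicator_apply_le' (fun _ => min_le_left _ _) (fun _ => zero_le)
  have hbound : ∀ N, ∫⁻ x, F N x ^ r ∂μ ≤ A ^ r := by
    intro N
    set J := ∫⁻ x, F N x ^ r ∂μ with hJ
    have hJf : J ≠ ⊤ := by
      have h1 : J ≤ ∫⁻ x, (spanningSets μ N).indicator (fun _ => (N : ℝ≥0∞) ^ r) x ∂μ := by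
        refine lintegral_mono fun x => ?_
        by_cases hx : x ∈ spanningSets μ N
        · simp only [hF, indicator_of_mem hx]
          gcongr
          exact min_le_right _ _
        · simp [hF, indicator_of_notMem hx, hr0]
      rw [lintegral_indicator_const (measurableSet_spanningSets μ N)] at h1
      refine ne_top_of_le_ne_top (ENNReal.mul_ne_top ?_ (measure_spanningSets_lt_top μ N).ne) h1
      exact ENNReal.rpow_ne_top_of_nonneg hr0.le (natCast_ne_top N)
    rcases eq_or_ne J 0 with hJ0 | hJ0
    · rw [hJ0]; exact zero_le
    have h2 : J ≤ A * J ^ (1 / q) := by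
      have h3 := H (fun x => F N x ^ (r - 1)) ((hFm N).pow_const _)
      have h4 : ∀ x, (F N x ^ (r - 1)) ^ q = F N x ^ r := by
        intro x
        rw [← ENNReal.rpow_mul, hrq.sub_one_mul_conj]
      simp_rw [h4] at h3
      refine le_trans (lintegral_mono fun x => ?_) h3
      calc F N x ^ r = F N x * F N x ^ (r - 1) := by
            conv_lhs => rw [show r = 1 + (r - 1) by ring]
            rw [ENNReal.rpow_add_of_nonneg _ _ (by norm_num) (by linarith), ENNReal.rpow_one]
        _ ≤ _ := by
            gcongr
            exact hFf N x
    have h5 : J = J ^ (1 / r) * J ^ (1 / q) := by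
      rw [← ENNReal.rpow_add _ _ hJ0 hJf, hrq.one_div_add_one_div, div_one, ENNReal.rpow_one]
    have h6 : J ^ (1 / q) ≠ 0 := (ENNReal.rpow_pos (pos_iff_ne_zero.2 hJ0) hJf).ne'
    have h7 : J ^ (1 / q) ≠ ⊤ := ENNReal.rpow_ne_top_of_nonneg (by positivity) hJf
    have h8 : J ^ (1 / r) ≤ A := by
      rw [← ENNReal.mul_le_mul_iff_left h6 h7, ← h5]
      exact h2
    calc J = (J ^ (1 / r)) ^ r := by
          rw [← ENNReal.rpow_mul, one_div_mul_cancel hr0.ne', ENNReal.rpow_one]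
      _ ≤ A ^ r := by gcongr
  refine le_of_tendsto' (lintegral_tendsto_of_tendsto_of_monotone
    (fun N => ((hFm N).pow_const r).aemeasurable) (ae_of_all _ fun x => ?_)
    (ae_of_all _ fun x => ?_)) hbound
  · intro N M hNM
    refine ENNReal.rpow_le_rpow ?_ hr0.le
    by_cases hx : x ∈ spanningSets μ N
    · simp only [hF, indicator_of_mem hx, indicator_of_mem (monotone_spanningSets μ hNM hx)]
      gcongr
    · simp only [hF, indicator_of_notMem hx]
      exact zero_le
  · refine (ENNReal.continuous_rpow_const.tendsto _).comp ?_
    have h1 : Tendsto (fun N : ℕ => min (f x) N) atTop (nhds (f x)) := by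
      have := (tendsto_const_nhds (x := f x)).min ENNReal.tendsto_nat_nhds_top
      rwa [min_eq_left le_top] at this
    refine h1.congr' ?_
    have hx : x ∈ ⋃ N, spanningSets μ N := by rw [iUnion_spanningSets]; trivial
    obtain ⟨M, hM⟩ := mem_iUnion.1 hx
    filter_upwards [eventually_ge_atTop M] with N hN
    simp only [hF, indicator_of_mem (monotone_spanningSets μ hN hM)]

theorem lintegral_coneEnergy_rpow_le_of_lt_one {n : ℕ} (hn : 1 ≤ n) {r : ℝ} (hr : 0 < r)
    (hr1 : r < 1) {α β τ : ℝ} (hα : 0 < α) (hβ : 0 < β) (hτ : 0 < τ) {g : ℝ → En n → ℝ}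
    (hg : Measurable (Function.uncurry g)) :
    ∫⁻ x, coneEnergy n β g x ^ r ≤ ENNReal.ofReal (τ ^ r * (2 * ((2 * β + 3 * α) / α) ^ n +
      2 * (β / α) ^ n / τ * (r / (1 - r)))) * ∫⁻ x, coneEnergy n α g x ^ r := by
  have hSα := measurable_coneEnergy α hg
  have hSβ := measurable_coneEnergy β hg
  have h1r : 0 < 1 - r := by linarith
  have key := lintegral_rpow_le_of_weak_below (μ := volume)
    (f := fun x => ENNReal.ofReal τ⁻¹ * coneEnergy n β g x) (hSβ.const_mul _) hSα
    (a := ENNReal.ofReal (2 * ((2 * β + 3 * α) / α) ^ n))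
    (b := ENNReal.ofReal (2 * (β / α) ^ n / τ)) hr hr1 ?_
  · have e : ∀ x, coneEnergy n β g x ^ r =
        ENNReal.ofReal (τ ^ r) * (ENNReal.ofReal τ⁻¹ * coneEnergy n β g x) ^ r := by
      intro x
      rw [← ENNReal.ofReal_rpow_of_pos hτ, ← ENNReal.mul_rpow_of_nonneg _ _ hr.le, ← mul_assoc,
        ← ENNReal.ofReal_mul hτ.le, mul_inv_cancel₀ hτ.ne', ENNReal.ofReal_one, one_mul]
    simp_rw [e]
    rw [lintegral_const_mul _ ((hSβ.const_mul _).pow_const _), ENNReal.ofReal_mul (by positivity),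
      mul_assoc, ENNReal.ofReal_add (by positivity) (by positivity),
      ENNReal.ofReal_mul (by positivity : 0 ≤ 2 * (β / α) ^ n / τ)]
    exact mul_le_mul' le_rfl key
  intro s hs
  set O := {x | ENNReal.ofReal s < coneEnergy n α g x} with hOdef
  have hO : MeasurableSet O := measurableSet_lt measurable_const hSα
  set G := {x | coneMaximal β α (O.indicator 1) x ≤ ENNReal.ofReal 2⁻¹} with hG
  have hGm : MeasurableSet G := measurableSet_le (measurable_coneMaximal _ _ _) measurable_const
  have hOc : Oᶜ = {x | coneEnergy n α g x ≤ ENNReal.ofReal s} := by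
    ext x; simp [hOdef]
  have hGc : Gᶜ = {x | ENNReal.ofReal 2⁻¹ < coneMaximal β α (O.indicator 1) x} := by
    ext x; simp only [hG, mem_compl_iff, mem_ofPred_eq, not_le]
  set f := fun x => ENNReal.ofReal τ⁻¹ * coneEnergy n β g x with hf
  have hfm : Measurable f := hSβ.const_mul _
  have h1 : volume {x | ENNReal.ofReal s < f x} ≤
      volume Gᶜ + volume.restrict G {x | ENNReal.ofReal s < f x} := by
    rw [Measure.restrict_apply (measurableSet_lt measurable_const hfm)]
    refine (measure_mono fun x hx => ?_).trans (measure_union_le _ _)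
    by_cases hxG : x ∈ G
    · exact Or.inr ⟨hx, hxG⟩
    · exact Or.inl hxG
  have h2 : volume Gᶜ ≤ ENNReal.ofReal (2 * ((2 * β + 3 * α) / α) ^ n) * volume O := by
    have := volume_lt_coneMaximal_le hn hβ hα (by positivity : (0 : ℝ) < 2⁻¹) (O.indicator 1)
    rw [lintegral_indicator_one hO, inv_inv, ← mul_assoc,
      ← ENNReal.ofReal_mul (by positivity), mul_comm _ (2 : ℝ)] at this
    rw [hGc]
    exact this
  have h3 : volume.restrict G {x | ENNReal.ofReal s < f x} ≤
      ENNReal.ofReal (2 * (β / α) ^ n / τ) *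
        (ENNReal.ofReal s⁻¹ * ∫⁻ x in Oᶜ, coneEnergy n α g x) := by
    have h4 := mul_meas_ge_le_lintegral (μ := volume.restrict G) hfm (ENNReal.ofReal s)
    have h5 : ∫⁻ x in G, f x ≤
        ENNReal.ofReal (2 * (β / α) ^ n / τ) * ∫⁻ x in Oᶜ, coneEnergy n α g x := by
      rw [hf, lintegral_const_mul _ hSβ]
      refine (mul_le_mul' le_rfl (weak_lintegral_coneEnergy_le hα hβ hg hO)).trans (le_of_eq ?_)
      rw [div_eq_mul_inv _ τ, mul_comm _ τ⁻¹, ENNReal.ofReal_mul (by positivity),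
        ENNReal.ofReal_mul two_pos.le, ENNReal.ofReal_ofNat]
      ring
    rw [mul_left_comm, ENNReal.ofReal_inv_of_pos hs,
      ← ENNReal.mul_le_iff_le_inv (by simpa using hs) ofReal_ne_top]
    refine le_trans (mul_le_mul' le_rfl (measure_mono fun x hx => ?_)) (h4.trans h5)
    rw [mem_ofPred_eq] at hx ⊢
    exact hx.le
  rw [hOc] at h3
  exact h1.trans (add_le_add h2 h3)

theorem lintegral_coneEnergy_rpow_le_of_one_lt {n : ℕ} (hn : 1 ≤ n) {r q : ℝ}
    (hrq : r.HolderConjugate q) {α β : ℝ} (hα : 0 < α) (hβ : 0 < β) {g : ℝ → En n → ℝ}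
    (hg : Measurable (Function.uncurry g)) :
    ∫⁻ x, coneEnergy n β g x ^ r ≤ ENNReal.ofReal (((β / α) ^ n) ^ r *
      (((2 * α + 3 * β) / β) ^ n * (2 ^ q * (q / (q - 1)))) ^ (r - 1)) *
        ∫⁻ x, coneEnergy n α g x ^ r := by
  have hSα := measurable_coneEnergy α hg
  have hSβ := measurable_coneEnergy β hg
  have hr0 := hrq.pos
  have hr1 : 0 < r - 1 := hrq.sub_one_pos
  have hq0 := hrq.symm.pos
  have hq1 : 0 < q - 1 := hrq.symm.sub_one_pos
  set D := ((2 * α + 3 * β) / β) ^ n * (2 ^ q * (q / (q - 1))) with hD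
  have hD0 : 0 < D := by positivity
  have key := lintegral_rpow_le_of_dual (μ := volume) hrq hSβ (A := ENNReal.ofReal ((β / α) ^ n) *
    ((∫⁻ x, coneEnergy n α g x ^ r) ^ (1 / r) * ENNReal.ofReal D ^ (1 / q))) ?_
  · refine key.trans (le_of_eq ?_)
    rw [ENNReal.mul_rpow_of_nonneg _ _ hr0.le, ENNReal.mul_rpow_of_nonneg _ _ hr0.le,
      ← ENNReal.rpow_mul, one_div_mul_cancel hr0.ne', ENNReal.rpow_one, ← ENNReal.rpow_mul,
      show 1 / q * r = r - 1 by rw [hrq.conjugate_eq]; field_simp,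
      ENNReal.ofReal_rpow_of_pos (by positivity), ENNReal.ofReal_rpow_of_pos hD0,
      ENNReal.ofReal_mul (by positivity)]
    ring
  intro h hh
  refine (lintegral_coneEnergy_mul_le_coneMaximal hα hβ hg hh).trans ?_
  rw [mul_assoc]
  refine mul_le_mul' le_rfl ?_
  refine (ENNReal.lintegral_mul_le_Lp_mul_Lq volume hrq hSα.aemeasurable
    (measurable_coneMaximal α β h).aemeasurable).trans ?_
  rw [mul_assoc, ← ENNReal.mul_rpow_of_nonneg _ _ (by positivity)]
  gcongr
  rw [hD, ENNReal.ofReal_mul (by positivity)]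
  exact lintegral_coneMaximal_rpow_le hn hα hβ hrq.symm.lt hh

theorem aperture_factor_le {a b : ℝ} (ha : 0 < a) (hb : 0 < b) (n : ℕ) :
    ((2 * b + 3 * a) / a) ^ n ≤ 5 ^ n * max 1 ((b / a) ^ n) := by
  rcases le_total b a with h | h
  · calc ((2 * b + 3 * a) / a) ^ n ≤ 5 ^ n := by
          gcongr
          rw [div_le_iff₀ ha]
          linarith
      _ ≤ _ := le_mul_of_one_le_right (by positivity) (le_max_left _ _)
  · calc ((2 * b + 3 * a) / a) ^ n ≤ (5 * (b / a)) ^ n := by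
          gcongr
          rw [mul_div_assoc', div_le_div_iff_of_pos_right ha]
          linarith
      _ = 5 ^ n * (b / a) ^ n := mul_pow _ _ _
      _ ≤ _ := by
          gcongr
          exact le_max_right _ _

/-- Change of aperture for the `L^r` quasi-norm of the cone energy. -/
theorem exists_lintegral_coneEnergy_rpow_le {n : ℕ} (hn : 1 ≤ n) {r : ℝ} (hr : 0 < r) :
    ∃ C : ℝ, 0 < C ∧ ∀ α β : ℝ, 0 < α → 0 < β → ∀ g : ℝ → En n → ℝ,
      Measurable (Function.uncurry g) → ∫⁻ x, coneEnergy n β g x ^ r ≤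
        ENNReal.ofReal (C * max (((β / α) ^ n) ^ r) ((β / α) ^ n)) *
          ∫⁻ x, coneEnergy n α g x ^ r := by
  rcases lt_trichotomy r 1 with hr1 | rfl | hr1
  · have h1r : 0 < 1 - r := by linarith
    refine ⟨2 * 5 ^ n + 2 * (r / (1 - r)), by positivity, fun α β hα hβ g hg => ?_⟩
    have hW := aperture_factor_le hα hβ n
    have hd : 0 < r / (1 - r) := by positivity
    set L := (β / α) ^ n with hL
    have hL0 : 0 < L := by positivity
    rcases le_total L 1 with hL1 | hL1
    · refine (lintegral_coneEnergy_rpow_le_of_lt_one hn hr hr1 hα hβ hL0 hg).trans ?_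
      rw [max_eq_left hL1] at hW
      refine mul_le_mul' (ENNReal.ofReal_le_ofReal ?_) le_rfl
      rw [mul_comm, ← hL, mul_div_assoc, div_self hL0.ne']
      gcongr ?_ * ?_
      · linarith
      · exact le_max_left _ _
    · refine (lintegral_coneEnergy_rpow_le_of_lt_one hn hr hr1 hα hβ one_pos hg).trans ?_
      rw [max_eq_right hL1] at hW
      refine mul_le_mul' (ENNReal.ofReal_le_ofReal ?_) le_rfl
      calc (1 : ℝ) ^ r * (2 * ((2 * β + 3 * α) / α) ^ n + 2 * (β / α) ^ n / 1 * (r / (1 - r)))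
          ≤ (2 * 5 ^ n + 2 * (r / (1 - r))) * L := by
            rw [Real.one_rpow, ← hL]
            linarith
        _ ≤ _ := by
            gcongr
            exact le_max_right _ _
  · refine ⟨1, one_pos, fun α β hα hβ g hg => ?_⟩
    simpa using lintegral_coneEnergy_le hα hβ hg
  · obtain ⟨q, hrq⟩ : ∃ q, r.HolderConjugate q := ⟨_, Real.HolderConjugate.conjExponent hr1⟩
    have hq0 := hrq.symm.pos
    have hq1 : 0 < q - 1 := hrq.symm.sub_one_pos
    have hr1' : 0 < r - 1 := hrq.sub_one_pos
    refine ⟨(5 ^ n * (2 ^ q * (q / (q - 1)))) ^ (r - 1), by positivity,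
      fun α β hα hβ g hg => ?_⟩
    refine (lintegral_coneEnergy_rpow_le_of_one_lt hn hrq hα hβ hg).trans ?_
    have hW := aperture_factor_le hβ hα n
    set D := 2 ^ q * (q / (q - 1)) with hD
    have hD0 : 0 < D := by positivity
    set L := (β / α) ^ n with hL
    have hL0 : 0 < L := by positivity
    rw [show (α / β) ^ n = L⁻¹ by rw [hL, ← inv_pow, inv_div]] at hW
    refine mul_le_mul' (ENNReal.ofReal_le_ofReal ?_) le_rfl
    rcases le_total L 1 with hL1 | hL1
    · rw [max_eq_right ((one_le_inv₀ hL0).2 hL1)] at hW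
      calc L ^ r * (((2 * α + 3 * β) / β) ^ n * D) ^ (r - 1)
          ≤ L ^ r * (5 ^ n * L⁻¹ * D) ^ (r - 1) := by gcongr
        _ = (5 ^ n * D) ^ (r - 1) * L := by
          rw [show 5 ^ n * L⁻¹ * D = 5 ^ n * D * L⁻¹ by ring,
            Real.mul_rpow (by positivity) (by positivity), Real.inv_rpow hL0.le,
            Real.rpow_sub_one hL0.ne']
          field_simp
        _ ≤ _ := by
          gcongr
          exact le_max_right _ _
    · rw [max_eq_left (inv_le_one_of_one_le₀ hL1), mul_one] at hW
      calc L ^ r * (((2 * α + 3 * β) / β) ^ n * D) ^ (r - 1)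
          ≤ L ^ r * (5 ^ n * D) ^ (r - 1) := by gcongr
        _ = (5 ^ n * D) ^ (r - 1) * L ^ r := mul_comm _ _
        _ ≤ _ := by
          gcongr
          exact le_max_left _ _

theorem tentNorm_eq_coneEnergy (n : ℕ) (p α : ℝ) (g : ℝ → En n → ℝ) :
    tentNorm n p α g = (∫⁻ x, coneEnergy n α g x ^ (p / 2)) ^ (1 / p) := by
  have h : ∀ x, conicalSq n α g x ^ p = coneEnergy n α g x ^ (p / 2) := by
    intro x
    rw [show p / 2 = 1 / 2 * p by ring, ENNReal.rpow_mul]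
    rfl
  simp only [tentNorm, h]

/-- One-sided change of aperture for tent space quasi-norms. -/
theorem exists_tentNorm_le {n : ℕ} (hn : 1 ≤ n) {p : ℝ} (hp : 0 < p) :
    ∃ C : ℝ, 0 < C ∧ ∀ α β : ℝ, 0 < α → 0 < β → ∀ g : ℝ → En n → ℝ,
      Measurable (Function.uncurry g) → tentNorm n p β g ≤
        ENNReal.ofReal (C * max ((α / β) ^ (-(n : ℝ) / 2)) ((α / β) ^ (-(n : ℝ) / p))) *
          tentNorm n p α g := by
  obtain ⟨C, hC, H⟩ := exists_lintegral_coneEnergy_rpow_le hn (by positivity : 0 < p / 2)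
  refine ⟨C ^ (1 / p), by positivity, fun α β hα hβ g hg => ?_⟩
  have hp' : 0 ≤ 1 / p := by positivity
  have hx : 0 < β / α := by positivity
  have e1 : (α / β) ^ (-(n : ℝ) / 2) = (((β / α) ^ n) ^ (p / 2)) ^ (1 / p) := by
    rw [← Real.rpow_mul (by positivity), ← Real.rpow_natCast, ← Real.rpow_mul hx.le,
      ← inv_div β α, Real.inv_rpow hx.le, ← Real.rpow_neg hx.le]
    congr 1
    field_simp
  have e2 : (α / β) ^ (-(n : ℝ) / p) = ((β / α) ^ n) ^ (1 / p) := by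
    rw [← Real.rpow_natCast, ← Real.rpow_mul hx.le,
      ← inv_div β α, Real.inv_rpow hx.le, ← Real.rpow_neg hx.le]
    congr 1
    field_simp
  have e3 : max ((((β / α) ^ n) ^ (p / 2)) ^ (1 / p)) (((β / α) ^ n) ^ (1 / p)) =
      (max (((β / α) ^ n) ^ (p / 2)) ((β / α) ^ n)) ^ (1 / p) :=
    ((Real.monotoneOn_rpow_Ici_of_exponent_nonneg hp').map_max
      (mem_Ici.2 (by positivity)) (mem_Ici.2 (by positivity))).symm
  rw [e1, e2, e3, ← Real.mul_rpow hC.le (le_max_of_le_right (by positivity)),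
    ← ENNReal.ofReal_rpow_of_nonneg (mul_nonneg hC.le (le_max_of_le_right (by positivity))) hp',
    tentNorm_eq_coneEnergy, tentNorm_eq_coneEnergy, ← ENNReal.mul_rpow_of_nonneg _ _ hp']
  exact ENNReal.rpow_le_rpow (H α β hα hβ g hg) hp'

/-- (Theorem 1: sharp change of angles.) There are constants `C, C' > 0`
depending only on `n, p` such that
`C min((α/β)^{-n/2},(α/β)^{-n/p}) ‖g‖_{T^{p,2}_α} ≤ ‖g‖_{T^{p,2}_β}
  ≤ C' max((α/β)^{-n/2},(α/β)^{-n/p}) ‖g‖_{T^{p,2}_α}`. -/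
theorem statement2 (n : ℕ) (hn : 1 ≤ n) (p : ℝ) (hp : 0 < p) :
    ∃ C C' : ℝ, 0 < C ∧ 0 < C' ∧
      ∀ α β : ℝ, 0 < α → 0 < β → ∀ g : ℝ → En n → ℝ, LocSqInt n g →
        ENNReal.ofReal (C * min ((α / β) ^ (-(n : ℝ) / 2)) ((α / β) ^ (-(n : ℝ) / p))) *
            tentNorm n p α g ≤ tentNorm n p β g ∧
        tentNorm n p β g ≤
          ENNReal.ofReal (C' * max ((α / β) ^ (-(n : ℝ) / 2)) ((α / β) ^ (-(n : ℝ) / p))) *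
            tentNorm n p α g := by
  obtain ⟨C, hC, H⟩ := exists_tentNorm_le hn hp
  refine ⟨C⁻¹, C, by positivity, hC, fun α β hα hβ g hg => ⟨?_, H α β hα hβ g hg.1⟩⟩
  have e : ∀ s : ℝ, (β / α) ^ s = ((α / β) ^ s)⁻¹ := fun s => by
    rw [← Real.inv_rpow (by positivity), inv_div]
  have hm : 0 < min ((α / β) ^ (-(n : ℝ) / 2)) ((α / β) ^ (-(n : ℝ) / p)) :=
    lt_min (by positivity) (by positivity)
  have hmax : max ((β / α) ^ (-(n : ℝ) / 2)) ((β / α) ^ (-(n : ℝ) / p)) =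
      (min ((α / β) ^ (-(n : ℝ) / 2)) ((α / β) ^ (-(n : ℝ) / p)))⁻¹ := by
    rw [e, e]
    rcases le_total ((α / β) ^ (-(n : ℝ) / 2)) ((α / β) ^ (-(n : ℝ) / p)) with h | h
    · rw [min_eq_left h, max_eq_left (inv_anti₀ (by positivity) h)]
    · rw [min_eq_right h, max_eq_right (inv_anti₀ (by positivity) h)]
  have h := H β α hβ hα g hg.1
  rw [hmax] at h
  refine (mul_le_mul' le_rfl h).trans (le_of_eq ?_)
  rw [← mul_assoc, ← ENNReal.ofReal_mul (by positivity)]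
  rw [show C⁻¹ * min ((α / β) ^ (-(n : ℝ) / 2)) ((α / β) ^ (-(n : ℝ) / p)) *
    (C * (min ((α / β) ^ (-(n : ℝ) / 2)) ((α / β) ^ (-(n : ℝ) / p)))⁻¹) = 1 by
      field_simp, ENNReal.ofReal_one, one_mul]

end
end

section
/- Let n ≥ 1 and 0 < p < ∞, and set σ = max(p, 2). There is a constant C > 0 depending only on n and p such that for every α ≥ 1 and every locally square integrable function g on (0,∞)×ℝⁿ, ‖g‖_{T^{p,2}_1} ≤ C α^{-n/σ} ‖g‖_{T^{p,2}_α}. -/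
open MeasureTheory Metric Set Filter ENNReal

noncomputable section

/-- Tonelli's theorem for a product function cut off to a measurable subset of the product. -/
lemma lintegral_mul_setLIntegral_swap_s4 {X Y : Type*} [MeasurableSpace X] [MeasurableSpace Y]
    {ν : Measure X} {ρ : Measure Y} [SFinite ν] [SFinite ρ] {w : X → ℝ≥0∞} {k : Y → ℝ≥0∞}
    (hw : Measurable w) (hk : Measurable k) {E : Set (X × Y)} (hE : MeasurableSet E) :
    ∫⁻ l, k l * ∫⁻ x in {x | (x, l) ∈ E}, w x ∂ν ∂ρ =
      ∫⁻ x, w x * ∫⁻ l in {l | (x, l) ∈ E}, k l ∂ρ ∂ν := by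
  have hm : Measurable (E.indicator fun z : X × Y => w z.1 * k z.2) :=
    ((hw.comp measurable_fst).mul (hk.comp measurable_snd)).indicator hE
  calc
    _ = ∫⁻ l, ∫⁻ x, E.indicator (fun z : X × Y => w z.1 * k z.2) (x, l) ∂ν ∂ρ := by
      refine lintegral_congr fun l => ?_
      have hEl : MeasurableSet {x | (x, l) ∈ E} := measurable_prodMk_right hE
      rw [← lintegral_const_mul _ hw, ← lintegral_indicator hEl]
      refine lintegral_congr fun x => ?_
      by_cases h : (x, l) ∈ E <;> simp [h, mul_comm]
    _ = ∫⁻ x, ∫⁻ l, E.indicator (fun z : X × Y => w z.1 * k z.2) (x, l) ∂ρ ∂ν :=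
      lintegral_lintegral_swap (hm.comp measurable_swap).aemeasurable
    _ = _ := by
      refine lintegral_congr fun x => ?_
      have hEx : MeasurableSet {l | (x, l) ∈ E} := measurable_prodMk_left hE
      rw [← lintegral_const_mul _ hk, ← lintegral_indicator hEx]
      refine lintegral_congr fun l => ?_
      by_cases h : (x, l) ∈ E <;> simp [h]

lemma lintegral_Ioo_rpow_sub_one {q s : ℝ} (hq : 0 < q) (hs : 0 ≤ s) :
    ∫⁻ l in Ioo 0 s, ENNReal.ofReal (l ^ (q - 1)) = ENNReal.ofReal (q⁻¹ * s ^ q) := by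
  rcases hs.eq_or_lt with rfl | hs'
  · simp [Real.zero_rpow hq.ne']
  rw [← ofReal_integral_eq_lintegral_ofReal, ← integral_Ioc_eq_integral_Ioo,
    ← intervalIntegral.integral_of_le hs, integral_rpow (Or.inl (by linarith))]
  · congr 1
    rw [sub_add_cancel, Real.zero_rpow hq.ne']
    field_simp
    ring
  · exact (intervalIntegral.integrableOn_Ioo_rpow_iff hs').2 (by linarith)
  · filter_upwards [ae_restrict_mem measurableSet_Ioo] with l hl
    exact Real.rpow_nonneg hl.1.le _

lemma measurableSet_ofReal_lt_s4 (s : ℝ≥0∞) : MeasurableSet {l : ℝ | ENNReal.ofReal l < s} :=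
  measurableSet_lt ENNReal.measurable_ofReal measurable_const

lemma setLIntegral_ofReal_lt_rpow {q : ℝ} (hq : 0 < q) (s : ℝ≥0∞) :
    ∫⁻ l in {l | ENNReal.ofReal l < s}, ENNReal.ofReal (l ^ (q - 1)) ∂(volume.restrict (Ioi 0)) =
      ENNReal.ofReal q⁻¹ * s ^ q := by
  rw [Measure.restrict_restrict (measurableSet_ofReal_lt_s4 s)]
  have hq' : 0 < q⁻¹ := inv_pos.2 hq
  induction s with
  | top =>
    rw [ENNReal.top_rpow_of_pos hq, ENNReal.mul_top (by simpa using hq)]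
    have hb : ∀ N : ℕ, ENNReal.ofReal (q⁻¹ * (N : ℝ) ^ q) ≤
        ∫⁻ l in {l | ENNReal.ofReal l < ⊤} ∩ Ioi 0, ENNReal.ofReal (l ^ (q - 1)) := fun N => by
      rw [← lintegral_Ioo_rpow_sub_one hq N.cast_nonneg]
      exact lintegral_mono_set fun l hl => ⟨by simp, hl.1⟩
    have ht : Tendsto (fun N : ℕ => ENNReal.ofReal (q⁻¹ * (N : ℝ) ^ q)) atTop (nhds ⊤) :=
      ENNReal.tendsto_ofReal_atTop.comp
        (((tendsto_rpow_atTop hq).comp tendsto_natCast_atTop_atTop).const_mul_atTop hq')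
    exact top_unique (le_of_tendsto ht (Eventually.of_forall hb))
  | coe s =>
    have : {l : ℝ | ENNReal.ofReal l < s} ∩ Ioi 0 = Ioo 0 (s : ℝ) := by
      ext l
      simp only [mem_inter_iff, mem_ofPred_eq, mem_Ioi, mem_Ioo]
      constructor
      · rintro ⟨h, h0⟩
        rw [← ENNReal.ofReal_coe_nnreal, ENNReal.ofReal_lt_ofReal_iff_of_nonneg h0.le] at h
        exact ⟨h0, h⟩
      · rintro ⟨h0, h⟩
        rw [← ENNReal.ofReal_coe_nnreal, ENNReal.ofReal_lt_ofReal_iff_of_nonneg h0.le]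
        exact ⟨h, h0⟩
    rw [this, lintegral_Ioo_rpow_sub_one hq s.coe_nonneg, ENNReal.ofReal_mul hq'.le,
      ← ENNReal.ofReal_rpow_of_nonneg s.coe_nonneg hq.le]
    simp

lemma setLIntegral_le_ofReal_rpow {r : ℝ} (hr : 0 < r) {s : ℝ≥0∞} (hs : s ≠ 0) :
    ∫⁻ l in {l | s ≤ ENNReal.ofReal l}, ENNReal.ofReal (l ^ (-r - 1)) ∂(volume.restrict (Ioi 0)) =
      ENNReal.ofReal r⁻¹ * s ^ (-r) := by
  rw [Measure.restrict_restrict (measurableSet_le measurable_const ENNReal.measurable_ofReal)]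
  induction s with
  | top => simp [ENNReal.top_rpow_of_neg (neg_lt_zero.2 hr)]
  | coe s =>
    have hs0 : (0 : ℝ) < s := by
      have : s ≠ 0 := by simpa using hs
      exact_mod_cast pos_iff_ne_zero.2 this
    have : {l : ℝ | (s : ℝ≥0∞) ≤ ENNReal.ofReal l} ∩ Ioi 0 = Ici (s : ℝ) := by
      ext l
      simp only [mem_inter_iff, mem_ofPred_eq, mem_Ioi, mem_Ici]
      rw [← ENNReal.ofReal_coe_nnreal, ENNReal.ofReal_le_ofReal_iff']
      constructor
      · rintro ⟨h | h, h0⟩ <;> linarith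
      · intro h
        exact ⟨Or.inl h, hs0.trans_le h⟩
    rw [this, ← restrict_Ioi_eq_restrict_Ici, ← ofReal_integral_eq_lintegral_ofReal,
      integral_Ioi_rpow_of_lt (by linarith) hs0, ← ENNReal.ofReal_coe_nnreal,
      ENNReal.ofReal_rpow_of_pos hs0, ← ENNReal.ofReal_mul (inv_pos.2 hr).le]
    · congr 1
      rw [sub_add_cancel]
      field_simp
    · exact integrableOn_Ioi_rpow_of_lt (by linarith) hs0
    · filter_upwards [ae_restrict_mem measurableSet_Ioi] with l hl
      exact Real.rpow_nonneg (hs0.trans hl).le _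

section LayerCake

variable {X : Type*} [MeasurableSpace X] {ν : Measure X} [SFinite ν] {f h : X → ℝ≥0∞} {K : ℝ≥0∞}

lemma measurableSet_prod_ofReal_lt (hf : Measurable f) :
    MeasurableSet {z : X × ℝ | ENNReal.ofReal z.2 < f z.1} :=
  measurableSet_lt (ENNReal.measurable_ofReal.comp measurable_snd) (hf.comp measurable_fst)

/-- The layer cake formula for powers of a function with values in `[0,∞]`. -/
lemma lintegral_ofReal_rpow_mul_measure_lt (hf : Measurable f) {q : ℝ} (hq : 0 < q) :
    ∫⁻ l in Ioi (0 : ℝ), ENNReal.ofReal (l ^ (q - 1)) * ν {x | ENNReal.ofReal l < f x} =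
      ENNReal.ofReal q⁻¹ * ∫⁻ x, f x ^ q ∂ν := by
  have := lintegral_mul_setLIntegral_swap_s4 (ν := ν) (ρ := volume.restrict (Ioi (0 : ℝ)))
    (measurable_const (a := (1 : ℝ≥0∞))) (k := fun l => ENNReal.ofReal (l ^ (q - 1)))
    (by fun_prop) (measurableSet_prod_ofReal_lt hf)
  simp only [mem_ofPred_eq, lintegral_const, one_mul, Measure.restrict_apply_univ,
    setLIntegral_ofReal_lt_rpow hq] at this
  rw [this, lintegral_const_mul _ (hf.pow_const q)]

lemma mul_rpow_sub_one_le (s : ℝ≥0∞) (q : ℝ) (hq : 0 < q) : s * s ^ (q - 1) ≤ s ^ q := by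
  rcases eq_or_ne s 0 with rfl | h0
  · simp
  rcases eq_or_ne s ⊤ with rfl | ht
  · simp [ENNReal.top_rpow_of_pos hq]
  · nth_rewrite 1 [← ENNReal.rpow_one s]
    rw [← ENNReal.rpow_add _ _ h0 ht]
    simp

lemma ofReal_rpow_mul_inv {l : ℝ} (hl : 0 < l) (q : ℝ) :
    ENNReal.ofReal (l ^ (q - 1)) * (ENNReal.ofReal l)⁻¹ = ENNReal.ofReal (l ^ (q - 2)) := by
  rw [← ENNReal.ofReal_inv_of_pos hl, ← ENNReal.ofReal_mul (by positivity),
    ← Real.rpow_neg_one l, ← Real.rpow_add hl]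
  ring_nf

lemma lintegral_rpow_eq_mul_lintegral (hf : Measurable f) {q : ℝ} (hq : 0 < q) :
    ∫⁻ x, f x ^ q ∂ν = ENNReal.ofReal q *
      ∫⁻ l in Ioi (0 : ℝ), ENNReal.ofReal (l ^ (q - 1)) * ν {x | ENNReal.ofReal l < f x} := by
  rw [lintegral_ofReal_rpow_mul_measure_lt hf hq, ← mul_assoc, ← ENNReal.ofReal_mul hq.le,
    mul_inv_cancel₀ hq.ne', ENNReal.ofReal_one, one_mul]

/-- A good-`λ` type inequality with the integral over large values gives `L^q` bounds, `q > 1`. -/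
lemma lintegral_rpow_le_of_measure_lt_le_of_one_lt (hf : Measurable f) (hh : Measurable h)
    (hK : K ≠ ⊤) {q : ℝ} (hq : 1 < q)
    (H : ∀ l : ℝ, 0 < l → ν {x | ENNReal.ofReal l < f x} ≤
      (ENNReal.ofReal l)⁻¹ * (K * ∫⁻ x in {x | ENNReal.ofReal l < h x}, h x ∂ν)) :
    ∫⁻ x, f x ^ q ∂ν ≤ ENNReal.ofReal (q * (q - 1)⁻¹) * K * ∫⁻ x, h x ^ q ∂ν := by
  have hq0 : 0 < q := by linarith
  have hT := lintegral_mul_setLIntegral_swap_s4 (ν := ν) (ρ := volume.restrict (Ioi (0 : ℝ)))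
    hh (k := fun l => ENNReal.ofReal (l ^ (q - 2))) (by fun_prop) (measurableSet_prod_ofReal_lt hh)
  simp only [mem_ofPred_eq] at hT
  calc
    _ ≤ ENNReal.ofReal q * ∫⁻ l in Ioi (0 : ℝ), K * (ENNReal.ofReal (l ^ (q - 2)) *
          ∫⁻ x in {x | ENNReal.ofReal l < h x}, h x ∂ν) := by
      rw [lintegral_rpow_eq_mul_lintegral hf hq0]
      refine mul_le_mul' le_rfl ?_
      refine setLIntegral_mono' measurableSet_Ioi fun l hl => ?_
      grw [H l hl]
      rw [← ofReal_rpow_mul_inv hl]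
      apply le_of_eq
      ring
    _ = ENNReal.ofReal q * (K * ∫⁻ x, h x * (ENNReal.ofReal (q - 1)⁻¹ * h x ^ (q - 1)) ∂ν) := by
      rw [lintegral_const_mul' _ _ hK, hT]
      simp_rw [show q - 2 = q - 1 - 1 by ring,
        setLIntegral_ofReal_lt_rpow (show 0 < q - 1 by linarith)]
    _ ≤ ENNReal.ofReal q * (K * ∫⁻ x, ENNReal.ofReal (q - 1)⁻¹ * h x ^ q ∂ν) := by
      refine mul_le_mul' le_rfl (mul_le_mul' le_rfl (lintegral_mono fun x => ?_))
      rw [mul_left_comm]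
      gcongr
      exact mul_rpow_sub_one_le _ _ hq0
    _ = _ := by
      rw [lintegral_const_mul _ (hh.pow_const q), ENNReal.ofReal_mul hq0.le]
      ring

/-- A good-`λ` type inequality with the integral over small values gives `L^q` bounds, `q < 1`. -/
lemma lintegral_rpow_le_of_measure_lt_le_of_lt_one (hf : Measurable f) (hh : Measurable h)
    (hK : K ≠ ⊤) {q : ℝ} (hq0 : 0 < q) (hq : q < 1)
    (H : ∀ l : ℝ, 0 < l → ν {x | ENNReal.ofReal l < f x} ≤
      K * ν {x | ENNReal.ofReal l < h x} +
      (ENNReal.ofReal l)⁻¹ * (K * ∫⁻ x in {x | h x ≤ ENNReal.ofReal l}, h x ∂ν)) :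
    ∫⁻ x, f x ^ q ∂ν ≤ ENNReal.ofReal (1 + q * (1 - q)⁻¹) * K * ∫⁻ x, h x ^ q ∂ν := by
  have hE : MeasurableSet {z : X × ℝ | h z.1 ≤ ENNReal.ofReal z.2} :=
    measurableSet_le (hh.comp measurable_fst) (ENNReal.measurable_ofReal.comp measurable_snd)
  have hT := lintegral_mul_setLIntegral_swap_s4 (ν := ν) (ρ := volume.restrict (Ioi (0 : ℝ)))
    hh (k := fun l => ENNReal.ofReal (l ^ (q - 2))) (by fun_prop) hE
  simp only [mem_ofPred_eq] at hT
  have hm : Measurable fun l : ℝ =>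
      ENNReal.ofReal (l ^ (q - 1)) * ν {x | ENNReal.ofReal l < h x} := by
    refine Measurable.mul (by fun_prop) ?_
    exact measurable_measure_prodMk_right (measurableSet_prod_ofReal_lt hh)
  calc
    _ ≤ ENNReal.ofReal q * ∫⁻ l in Ioi (0 : ℝ), (K * (ENNReal.ofReal (l ^ (q - 1)) *
          ν {x | ENNReal.ofReal l < h x}) + K * (ENNReal.ofReal (l ^ (q - 2)) *
          ∫⁻ x in {x | h x ≤ ENNReal.ofReal l}, h x ∂ν)) := by
      rw [lintegral_rpow_eq_mul_lintegral hf hq0]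
      refine mul_le_mul' le_rfl ?_
      refine setLIntegral_mono' measurableSet_Ioi fun l hl => ?_
      grw [H l hl]
      rw [← ofReal_rpow_mul_inv hl]
      apply le_of_eq
      ring
    _ = ENNReal.ofReal q * (K * (ENNReal.ofReal q⁻¹ * ∫⁻ x, h x ^ q ∂ν) +
          K * ∫⁻ x, h x * ∫⁻ l in {l | h x ≤ ENNReal.ofReal l}, ENNReal.ofReal (l ^ (q - 2))
            ∂(volume.restrict (Ioi 0)) ∂ν) := by
      rw [lintegral_add_left (hm.const_mul K), lintegral_const_mul' _ _ hK,
        lintegral_const_mul' _ _ hK, hT, lintegral_ofReal_rpow_mul_measure_lt hh hq0]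
    _ ≤ ENNReal.ofReal q * (K * (ENNReal.ofReal q⁻¹ * ∫⁻ x, h x ^ q ∂ν) +
          K * ∫⁻ x, ENNReal.ofReal (1 - q)⁻¹ * h x ^ q ∂ν) := by
      refine mul_le_mul' le_rfl (add_le_add le_rfl (mul_le_mul' le_rfl (lintegral_mono fun x => ?_)))
      rcases eq_or_ne (h x) 0 with h0 | h0
      · simp [h0]
      rw [show q - 2 = -(1 - q) - 1 by ring,
        setLIntegral_le_ofReal_rpow (show 0 < 1 - q by linarith) h0, mul_left_comm]
      gcongr
      rw [neg_sub]
      exact mul_rpow_sub_one_le _ _ hq0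
    _ = _ := by
      have h1 : ENNReal.ofReal q * ENNReal.ofReal q⁻¹ = 1 := by
        rw [← ENNReal.ofReal_mul hq0.le, mul_inv_cancel₀ hq0.ne', ENNReal.ofReal_one]
      have h2 : 0 < (1 - q)⁻¹ := inv_pos.2 (by linarith)
      rw [lintegral_const_mul _ (hh.pow_const q), ENNReal.ofReal_add one_pos.le (by positivity),
        ENNReal.ofReal_mul hq0.le, ENNReal.ofReal_one, ← h1]
      ring

end LayerCake

/-- The cone of aperture `α` with vertex `x`. -/
def cone {n : ℕ} (α : ℝ) (x : En n) : Set (ℝ × En n) := {z | dist z.2 x < α * z.1}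

section Cone

variable {n : ℕ} {α : ℝ}

lemma isOpen_cone (x : En n) : IsOpen (cone α x) :=
  isOpen_lt (by fun_prop) (by fun_prop)

lemma measurableSet_prod_cone : MeasurableSet {z : En n × (ℝ × En n) | z.2 ∈ cone α z.1} :=
  (isOpen_lt (f := fun z : En n × (ℝ × En n) => dist z.2.2 z.1) (g := fun z => α * z.2.1)
    (by fun_prop) (by fun_prop)).measurableSet

lemma cone_mono {β : ℝ} (hα : 0 < α) (h : α ≤ β) (x : En n) : cone α x ⊆ cone β x := by
  intro z hz
  have hz' : dist z.2 x < α * z.1 := hz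
  have : 0 < z.1 := pos_of_mul_pos_right (dist_nonneg.trans_lt hz') hα.le
  exact hz'.trans_le (by gcongr)

lemma isOpen_lt_measure_cone (μ : Measure (ℝ × En n)) (l : ℝ≥0∞) :
    IsOpen {x : En n | l < μ (cone α x)} := by
  rw [Metric.isOpen_iff]
  intro x (hx : l < μ (cone α x))
  have hU : cone α x = ⋃ k : ℕ, {z : ℝ × En n | dist z.2 x + 1 / ((k : ℝ) + 1) < α * z.1} := by
    ext z
    simp only [cone, mem_ofPred_eq, mem_iUnion]
    constructor
    · intro h
      obtain ⟨k, hk⟩ := exists_nat_one_div_lt (sub_pos.2 h)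
      exact ⟨k, by linarith⟩
    · rintro ⟨k, hk⟩
      have : 0 < 1 / ((k : ℝ) + 1) := by positivity
      linarith
  have hmono : Monotone fun k : ℕ => {z : ℝ × En n | dist z.2 x + 1 / ((k : ℝ) + 1) < α * z.1} := by
    intro k m hkm z hz
    simp only [mem_ofPred_eq] at hz ⊢
    have : 1 / ((m : ℝ) + 1) ≤ 1 / ((k : ℝ) + 1) := by gcongr
    linarith
  rw [hU, hmono.measure_iUnion, lt_iSup_iff] at hx
  obtain ⟨k, hk⟩ := hx
  refine ⟨1 / ((k : ℝ) + 1), by positivity, fun w hw => hk.trans_le (measure_mono ?_)⟩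
  intro z hz
  simp only [cone, mem_ofPred_eq] at hz ⊢
  have h2 := dist_triangle z.2 x w
  rw [mem_ball'] at hw
  linarith

lemma measurable_measure_cone (μ : Measure (ℝ × En n)) :
    Measurable fun x : En n => μ (cone α x) :=
  measurable_of_Ioi fun l => (isOpen_lt_measure_cone μ l).measurableSet

lemma measurable_measure_ball (ν : Measure (En n)) [SFinite ν] :
    Measurable fun z : ℝ × En n => ν (ball z.2 (α * z.1)) := by
  have := measurable_measure_prodMk_right (μ := ν) (measurableSet_prod_cone (n := n) (α := α))
  convert this using 4 with z
  ext x
  simp [cone, dist_comm]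

/-- Tonelli's theorem for integrals over cones. -/
lemma lintegral_measure_cone (μ : Measure (ℝ × En n)) [SFinite μ] (ν : Measure (En n))
    [SFinite ν] : ∫⁻ x, μ (cone α x) ∂ν = ∫⁻ z, ν (ball z.2 (α * z.1)) ∂μ := by
  have h := lintegral_mul_setLIntegral_swap_s4 (ν := ν) (ρ := μ) (w := 1) (k := 1)
    measurable_one measurable_one (measurableSet_prod_cone (n := n) (α := α))
  simp only [Pi.one_apply, one_mul, lintegral_one, Measure.restrict_apply_univ] at h
  refine h.symm.trans (lintegral_congr fun z => ?_)
  congr 1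
  ext x
  simp [cone, dist_comm]

lemma volume_ball_eq_mul (x y : En n) {c r : ℝ} (hc : 0 < c) :
    volume (ball x (c * r)) = ENNReal.ofReal (c ^ n) * volume (ball y r) := by
  rw [Measure.addHaar_ball_mul_of_pos volume x hc, Measure.addHaar_ball_center volume y,
    finrank_euclideanSpace_fin]

lemma lt_of_lt_mul_of_dist_nonneg {β t : ℝ} {y x : En n} (hβ : 0 < β) (h : dist y x < β * t) :
    0 < t :=
  pos_of_mul_pos_right (dist_nonneg.trans_lt h) hβ.le

/-- Weak type bound: large values of the square function on a unit cone are controlled by the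
large values on a wide cone. -/
lemma measure_lt_cone_le_of_large (hα : 4 ≤ α) (μ : Measure (ℝ × En n)) [SFinite μ] {l : ℝ}
    (hl : 0 < l) :
    volume {x : En n | ENNReal.ofReal l < 2⁻¹ * μ (cone 1 x)} ≤
      (ENNReal.ofReal l)⁻¹ * (ENNReal.ofReal ((2 / α) ^ n) *
        ∫⁻ x in {x : En n | ENNReal.ofReal l < μ (cone α x)}, μ (cone α x)) := by
  have hα0 : 0 < α := by linarith
  set O := {x : En n | ENNReal.ofReal l < μ (cone α x)} with hO
  have hOo : IsOpen O := isOpen_lt_measure_cone μ _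
  set G := {z : ℝ × En n | ball z.2 (α / 2 * z.1) ⊆ O} with hG
  have hmain : ∀ x, μ (cone 1 x) ≤ ENNReal.ofReal l + μ.restrict G (cone 1 x) := by
    intro x
    by_cases hx : x ∈ O
    swap
    · have : μ (cone α x) ≤ ENNReal.ofReal l := not_lt.1 hx
      exact (measure_mono (cone_mono one_pos (by linarith) x)).trans (this.trans le_self_add)
    rw [Measure.restrict_apply (isOpen_cone x).measurableSet, add_comm]
    refine (measure_le_inter_add_sdiff μ _ G).trans (add_le_add le_rfl ?_)
    rcases Set.eq_empty_or_nonempty Oᶜ with hE | hne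
    · have : G = univ := by
        rw [compl_empty_iff] at hE
        simp [hG, hE]
      simp [this]
    obtain ⟨z₀, hz₀, hd⟩ := hOo.isClosed_compl.exists_infDist_eq_dist hne x
    refine le_trans (measure_mono ?_) (not_lt.1 hz₀ : μ (cone α z₀) ≤ _)
    rintro ⟨t, y⟩ ⟨h1 : dist y x < 1 * t, h2⟩
    obtain ⟨z, hz, hzO⟩ := not_subset.1 h2
    have h3 : dist x z₀ ≤ dist x z := hd ▸ infDist_le_dist_of_mem hzO
    have h4 := dist_triangle_left x z y
    have h5 := dist_triangle y x z₀
    have h6 : dist z y < α / 2 * t := hz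
    rw [dist_comm z y] at h6
    have ht := lt_of_lt_mul_of_dist_nonneg one_pos h1
    change dist y z₀ < α * t
    nlinarith
  have hsub : {x : En n | ENNReal.ofReal l < 2⁻¹ * μ (cone 1 x)} ⊆
      {x | ENNReal.ofReal l ≤ μ.restrict G (cone 1 x)} := by
    intro x hx
    simp only [mem_ofPred_eq] at hx ⊢
    by_contra! hlt
    have : 2⁻¹ * μ (cone 1 x) ≤ 2⁻¹ * (ENNReal.ofReal l + ENNReal.ofReal l) := by
      gcongr
      exact (hmain x).trans (by gcongr)
    rw [← two_mul, ← mul_assoc, ENNReal.inv_mul_cancel two_ne_zero ofNat_ne_top, one_mul] at this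
    exact absurd hx (not_lt.2 this)
  have hl' : ENNReal.ofReal l ≠ 0 := by simpa using hl
  refine (measure_mono hsub).trans
    ((meas_ge_le_lintegral_div (measurable_measure_cone _).aemeasurable hl' ofReal_ne_top).trans ?_)
  rw [ENNReal.div_eq_inv_mul]
  refine mul_le_mul' le_rfl ?_
  rw [lintegral_measure_cone, lintegral_measure_cone,
    ← lintegral_const_mul _ (measurable_measure_ball _)]
  refine (setLIntegral_mono ((measurable_measure_ball (volume.restrict O)).const_mul _) ?_).trans
    (lintegral_mono' Measure.restrict_le_self le_rfl)
  rintro ⟨t, y⟩ (hz : ball y (α / 2 * t) ⊆ O)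
  rcases le_or_gt t 0 with ht | ht
  · rw [ball_eq_empty.2 (show 1 * t ≤ 0 by linarith), measure_empty]
    exact zero_le
  calc
    volume (ball y (1 * t)) = volume (ball y (2 / α * (α / 2 * t))) := by
      congr 2
      field_simp
    _ = ENNReal.ofReal ((2 / α) ^ n) * volume (ball y (α / 2 * t)) :=
      volume_ball_eq_mul _ _ (by positivity)
    _ ≤ _ := by
      refine mul_le_mul' le_rfl ?_
      rw [Measure.restrict_apply measurableSet_ball]
      refine measure_mono (subset_inter (ball_subset_ball ?_) hz)
      nlinarith

/-- The points around which `O` fills more than half of some ball. -/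
def halfDense (O : Set (En n)) : Set (En n) :=
  {x | ∃ r : ℝ, 0 < r ∧ volume (ball x r) < 2 * volume (O ∩ ball x r)}

lemma volume_halfDense_le (hn : 1 ≤ n) (O : Set (En n)) :
    volume (halfDense O) ≤ ENNReal.ofReal (2 * 5 ^ n) * volume O := by
  rcases eq_or_ne (volume O) ⊤ with htop | hfin
  · rw [htop, ENNReal.mul_top (by simp only [ne_eq, ENNReal.ofReal_eq_zero, not_le]; positivity)]
    exact le_top
  have : Nonempty (Fin n) := ⟨⟨0, hn⟩⟩
  choose! r hr hrO using fun (x : En n) (hx : x ∈ halfDense O) => hx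
  set v := volume (ball (0 : En n) 1) with hv
  have hv0 : v ≠ 0 := (measure_ball_pos volume _ one_pos).ne'
  have hvt : v ≠ ⊤ := measure_ball_lt_top.ne
  have hbd : ∀ x ∈ halfDense O, r x ≤ 1 + (2 * volume O / v).toReal := by
    intro x hx
    rcases le_or_gt (r x) 1 with h1 | h1
    · exact h1.trans (le_add_of_nonneg_right toReal_nonneg)
    have h2 : ENNReal.ofReal (r x) * v ≤ 2 * volume O := by
      calc
        _ ≤ ENNReal.ofReal (r x ^ n) * v := by
          gcongr
          exact le_self_pow₀ h1.le (by omega)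
        _ = volume (ball x (r x)) := by
          rw [hv, ← volume_ball_eq_mul x 0 (hr x hx), mul_one]
        _ ≤ _ := (hrO x hx).le.trans (by gcongr; exact inter_subset_left)
    rw [← ENNReal.le_div_iff_mul_le (Or.inl hv0) (Or.inl hvt)] at h2
    have h3 : 2 * volume O / v ≠ ⊤ :=
      ENNReal.div_ne_top (ENNReal.mul_ne_top ofNat_ne_top hfin) hv0
    have := (ENNReal.ofReal_le_iff_le_toReal h3).1 h2
    linarith
  obtain ⟨u, hu, hdisj, hcov⟩ := Vitali.exists_disjoint_subfamily_covering_enlargement_closedBall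
    (halfDense O) id r _ hbd 5 (by norm_num)
  have huc : u.Countable := hdisj.countable_of_nonempty_interior fun x hx =>
    ⟨x, ball_subset_interior_closedBall (mem_ball_self (hr x (hu hx)))⟩
  have hdisj' : u.PairwiseDisjoint fun x => ball x (r x) :=
    hdisj.mono_on fun x _ => ball_subset_closedBall
  calc
    volume (halfDense O) ≤ volume (⋃ x ∈ u, closedBall x (5 * r x)) := by
      refine measure_mono fun x hx => ?_
      obtain ⟨b, hb, hsub⟩ := hcov x hx
      exact mem_iUnion₂.2 ⟨b, hb, hsub (mem_closedBall_self (hr x hx).le)⟩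
    _ ≤ ∑' x : u, volume (closedBall (x : En n) (5 * r x)) := measure_biUnion_le _ huc _
    _ ≤ ∑' x : u, ENNReal.ofReal (2 * 5 ^ n) * volume.restrict O (ball (x : En n) (r x)) := by
      refine ENNReal.tsum_le_tsum fun ⟨x, hx⟩ => ?_
      rw [Measure.addHaar_closedBall_eq_addHaar_ball, volume_ball_eq_mul x x (by norm_num),
        Measure.restrict_apply measurableSet_ball, inter_comm, mul_comm 2,
        ENNReal.ofReal_mul (by positivity), mul_assoc]
      gcongr
      simpa using (hrO x (hu hx)).le
    _ = ENNReal.ofReal (2 * 5 ^ n) * volume.restrict O (⋃ x ∈ u, ball x (r x)) := by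
      rw [ENNReal.tsum_mul_left, measure_biUnion huc hdisj' fun _ _ => measurableSet_ball]
    _ ≤ _ := by
      refine mul_le_mul' le_rfl ?_
      exact (measure_mono (subset_univ _)).trans_eq (Measure.restrict_apply_univ _)

lemma volume_ball_le_of_notMem_halfDense {O : Set (En n)} (hO : MeasurableSet O) {x : En n}
    (hx : x ∉ halfDense O) {r : ℝ} (hr : 0 < r) :
    volume (ball x r) ≤ 2 * volume (ball x r ∩ Oᶜ) := by
  have h1 : 2 * volume (O ∩ ball x r) ≤ volume (ball x r) := by
    by_contra! h
    exact hx ⟨r, hr, h⟩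
  have h2 := measure_inter_add_sdiff (μ := volume) (ball x r) hO
  have ht : volume (ball x r) ≠ ⊤ := measure_ball_lt_top.ne
  rw [inter_comm] at h1
  rw [← sdiff_eq]
  refine (ENNReal.add_le_add_iff_left ht).1 ?_
  calc
    volume (ball x r) + volume (ball x r)
        = 2 * volume (ball x r ∩ O) + 2 * volume (ball x r \ O) := by rw [← mul_add, h2, two_mul]
    _ ≤ _ := by gcongr

/-- Weak type bound: large values of the square function on a unit cone are controlled by the
level sets and the small values on a wide cone. -/
lemma measure_lt_cone_le_of_small (hn : 1 ≤ n) (hα : 4 ≤ α) (μ : Measure (ℝ × En n)) [SFinite μ]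
    {l : ℝ} (hl : 0 < l) :
    volume {x : En n | ENNReal.ofReal l < ENNReal.ofReal (α ^ n) * μ (cone 1 x)} ≤
      ENNReal.ofReal (2 * 5 ^ n) * volume {x : En n | ENNReal.ofReal l < μ (cone α x)} +
      (ENNReal.ofReal l)⁻¹ * (ENNReal.ofReal (2 * 5 ^ n) *
        ∫⁻ x in {x : En n | μ (cone α x) ≤ ENNReal.ofReal l}, μ (cone α x)) := by
  have hα0 : 0 < α := by linarith
  set O := {x : En n | ENNReal.ofReal l < μ (cone α x)} with hO
  have hOm : MeasurableSet O := (isOpen_lt_measure_cone μ _).measurableSet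
  have hF : {x : En n | μ (cone α x) ≤ ENNReal.ofReal l} = Oᶜ := by
    ext x
    simp [hO]
  set D := halfDense O
  set f : En n → ℝ≥0∞ := fun x => ENNReal.ofReal (α ^ n) * μ (cone 1 x)
  have hfm : Measurable f := (measurable_measure_cone μ).const_mul _
  set A := {x : En n | ENNReal.ofReal l < f x}
  have hA : MeasurableSet A := measurableSet_lt measurable_const hfm
  have hl' : ENNReal.ofReal l ≠ 0 := by simpa using hl
  rw [hF]
  calc
    volume A ≤ volume (D ∪ A ∩ Dᶜ) := measure_mono fun x hx => by
      by_cases h : x ∈ D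
      · exact Or.inl h
      · exact Or.inr ⟨hx, h⟩
    _ ≤ volume D + volume.restrict Dᶜ A := by
      rw [Measure.restrict_apply hA]
      exact measure_union_le _ _
    _ ≤ _ := by
      refine add_le_add (volume_halfDense_le hn O) ?_
      refine (measure_mono (t := {x | ENNReal.ofReal l ≤ f x})
        fun x (hx : ENNReal.ofReal l < f x) => hx.le).trans
        ((meas_ge_le_lintegral_div hfm.aemeasurable hl' ofReal_ne_top).trans ?_)
      rw [ENNReal.div_eq_inv_mul]
      refine mul_le_mul' le_rfl ?_
      rw [lintegral_const_mul _ (measurable_measure_cone μ),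
        lintegral_measure_cone, lintegral_measure_cone,
        ← lintegral_const_mul _ (measurable_measure_ball _),
        ← lintegral_const_mul _ (measurable_measure_ball _)]
      refine lintegral_mono fun ⟨t, y⟩ => ?_
      change _ * volume.restrict Dᶜ (ball y (1 * t)) ≤ _ * volume.restrict Oᶜ (ball y (α * t))
      rw [Measure.restrict_apply measurableSet_ball, Measure.restrict_apply measurableSet_ball]
      rcases Set.eq_empty_or_nonempty (ball y (1 * t) ∩ Dᶜ) with hE | ⟨x, hxy, hxD⟩
      · rw [hE, measure_empty, mul_zero]
        exact zero_le
      have hxy' : dist x y < 1 * t := hxy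
      have ht := lt_of_lt_mul_of_dist_nonneg one_pos hxy'
      calc
        ENNReal.ofReal (α ^ n) * volume (ball y (1 * t) ∩ Dᶜ)
            ≤ ENNReal.ofReal (α ^ n) * volume (ball y (1 * t)) := by
          gcongr
          exact inter_subset_left
        _ = volume (ball x (2 * (α / 2 * t))) := by
          rw [← volume_ball_eq_mul x y hα0]
          congr 2
          ring
        _ = ENNReal.ofReal (2 ^ n) * volume (ball x (α / 2 * t)) :=
          volume_ball_eq_mul x x two_pos
        _ ≤ ENNReal.ofReal (2 ^ n) * (2 * volume (ball x (α / 2 * t) ∩ Oᶜ)) := by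
          gcongr
          exact volume_ball_le_of_notMem_halfDense hOm hxD (by positivity)
        _ = ENNReal.ofReal (2 * 2 ^ n) * volume (ball x (α / 2 * t) ∩ Oᶜ) := by
          rw [ENNReal.ofReal_mul two_pos.le, ENNReal.ofReal_ofNat]
          ring
        _ ≤ _ := by
          gcongr
          · norm_num
          · refine ball_subset_ball' ?_
            nlinarith

/-- The change of aperture inequality for square functions of measures, for wide cones. -/
lemma exists_lintegral_cone_rpow_le_of_four_le (hn : 1 ≤ n) {q : ℝ} (hq : 0 < q) :
    ∃ C : ℝ, 0 < C ∧ ∀ α : ℝ, 4 ≤ α → ∀ (μ : Measure (ℝ × En n)) [SFinite μ],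
      ∫⁻ x : En n, μ (cone 1 x) ^ q ≤
        ENNReal.ofReal (C * α ^ (-(n : ℝ) * min 1 q)) * ∫⁻ x : En n, μ (cone α x) ^ q := by
  rcases lt_trichotomy q 1 with h1 | rfl | h1
  · have hc : 0 < (1 - q)⁻¹ := inv_pos.2 (by linarith)
    refine ⟨(1 + q * (1 - q)⁻¹) * (2 * 5 ^ n), by positivity, fun α hα μ _ => ?_⟩
    have hα0 : 0 < α := by linarith
    have key := lintegral_rpow_le_of_measure_lt_le_of_lt_one
      ((measurable_measure_cone μ).const_mul (ENNReal.ofReal (α ^ n)))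
      (measurable_measure_cone (α := α) μ) ofReal_ne_top hq h1
      fun l hl => measure_lt_cone_le_of_small hn hα μ hl
    simp_rw [ENNReal.mul_rpow_of_nonneg _ _ hq.le] at key
    rw [lintegral_const_mul _ ((measurable_measure_cone μ).pow_const q),
      ENNReal.ofReal_rpow_of_pos (by positivity), ← ENNReal.ofReal_mul (by positivity)] at key
    have hinv : α ^ (-(n : ℝ) * min 1 q) * (α ^ n) ^ q = 1 := by
      rw [min_eq_right h1.le, ← Real.rpow_natCast_mul hα0.le, ← Real.rpow_add hα0]
      simp
    calc
      _ = ENNReal.ofReal (α ^ (-(n : ℝ) * min 1 q)) *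
          (ENNReal.ofReal ((α ^ n) ^ q) * ∫⁻ x : En n, μ (cone 1 x) ^ q) := by
        rw [← mul_assoc, ← ENNReal.ofReal_mul (by positivity), hinv, ENNReal.ofReal_one, one_mul]
      _ ≤ _ := by
        grw [key]
        rw [← mul_assoc, ← ENNReal.ofReal_mul (by positivity), mul_comm (α ^ _)]
  · refine ⟨1, one_pos, fun α hα μ _ => ?_⟩
    have hα0 : 0 < α := by linarith
    simp_rw [ENNReal.rpow_one]
    rw [lintegral_measure_cone, lintegral_measure_cone,
      ← lintegral_const_mul _ (measurable_measure_ball _)]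
    refine lintegral_mono fun ⟨t, y⟩ => le_of_eq ?_
    have : (1 : ℝ) * α ^ (-(n : ℝ) * min 1 1) = α⁻¹ ^ n := by
      rw [min_self, mul_one, one_mul, Real.rpow_neg hα0.le, Real.rpow_natCast, inv_pow]
    rw [this, ← volume_ball_eq_mul y y (inv_pos.2 hα0)]
    congr 2
    field_simp
  · have hc : 0 < (q - 1)⁻¹ := inv_pos.2 (by linarith)
    refine ⟨2 ^ q * (q * (q - 1)⁻¹ * 2 ^ n), by positivity, fun α hα μ _ => ?_⟩
    have hα0 : 0 < α := by linarith
    have key := lintegral_rpow_le_of_measure_lt_le_of_one_lt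
      ((measurable_measure_cone μ).const_mul 2⁻¹)
      (measurable_measure_cone (α := α) μ) ofReal_ne_top h1
      fun l hl => measure_lt_cone_le_of_large hα μ hl
    simp_rw [ENNReal.mul_rpow_of_nonneg _ _ hq.le] at key
    rw [lintegral_const_mul _ ((measurable_measure_cone μ).pow_const q),
      ← ENNReal.ofReal_mul (by positivity), ENNReal.inv_rpow] at key
    have h2 : (2 : ℝ≥0∞) ^ q = ENNReal.ofReal (2 ^ q) := by
      rw [← ENNReal.ofReal_rpow_of_pos two_pos, ENNReal.ofReal_ofNat]
    have hpow : (2 / α) ^ n = 2 ^ n * α ^ (-(n : ℝ) * min 1 q) := by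
      rw [min_eq_left h1.le, mul_one, Real.rpow_neg hα0.le, Real.rpow_natCast, div_pow,
        div_eq_mul_inv]
    calc
      _ = 2 ^ q * ((2 ^ q)⁻¹ * ∫⁻ x : En n, μ (cone 1 x) ^ q) := by
        rw [← mul_assoc, ENNReal.mul_inv_cancel (by simp) (by simp), one_mul]
      _ ≤ _ := by
        grw [key]
        rw [hpow, ← mul_assoc, h2, ← ENNReal.ofReal_mul (by positivity)]
        apply le_of_eq
        congr 2
        ring

/-- The change of aperture inequality for square functions of measures. -/
lemma exists_lintegral_cone_rpow_le (hn : 1 ≤ n) {q : ℝ} (hq : 0 < q) :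
    ∃ C : ℝ, 0 < C ∧ ∀ α : ℝ, 1 ≤ α → ∀ (μ : Measure (ℝ × En n)) [SFinite μ],
      ∫⁻ x : En n, μ (cone 1 x) ^ q ≤
        ENNReal.ofReal (C * α ^ (-(n : ℝ) * min 1 q)) * ∫⁻ x : En n, μ (cone α x) ^ q := by
  obtain ⟨C, hC, H⟩ := exists_lintegral_cone_rpow_le_of_four_le hn hq
  refine ⟨C + 4 ^ n, by positivity, fun α hα μ _ => ?_⟩
  have hα0 : 0 < α := by linarith
  rcases le_or_gt 4 α with h4 | h4
  · refine (H α h4 μ).trans ?_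
    gcongr
    exact le_add_of_nonneg_right (by positivity)
  · have hone : 1 ≤ (C + 4 ^ n) * α ^ (-(n : ℝ) * min 1 q) := by
      calc
        (1 : ℝ) = 4 ^ n * (4 ^ n)⁻¹ := by field_simp
        _ ≤ (C + 4 ^ n) * (α ^ n)⁻¹ := by
          gcongr
          exact le_add_of_nonneg_left hC.le
        _ ≤ _ := by
          rw [← Real.rpow_natCast α, ← Real.rpow_neg hα0.le]
          gcongr
          have : min 1 q ≤ 1 := min_le_left _ _
          have : (0 : ℝ) ≤ n := n.cast_nonneg
          nlinarith
    calc
      _ ≤ 1 * ∫⁻ x : En n, μ (cone α x) ^ q := by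
        rw [one_mul]
        gcongr with x
        exact cone_mono one_pos hα x
      _ ≤ _ := by
        gcongr
        exact ENNReal.one_le_ofReal.2 hone

end Cone

/-- The measure with density `|g(t,y)|² / t^{n+1}` on the upper half space. -/
def sqMeasure (n : ℕ) (g : ℝ → En n → ℝ) : Measure (ℝ × En n) :=
  ((volume.restrict (Ioi 0)).prod volume).withDensity
    fun z => ENNReal.ofReal (|g z.1 z.2| ^ 2 / z.1 ^ (n + 1))

instance (n : ℕ) (g : ℝ → En n → ℝ) : SFinite (sqMeasure n g) := by
  unfold sqMeasure
  infer_instance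

lemma conicalSq_eq {n : ℕ} {g : ℝ → En n → ℝ} (hg : Measurable (Function.uncurry g)) (α : ℝ)
    (x : En n) : conicalSq n α g x = sqMeasure n g (cone α x) ^ (1 / 2 : ℝ) := by
  have hg' : Measurable fun z : ℝ × En n => g z.1 z.2 := hg
  have hF : Measurable fun z : ℝ × En n =>
      ENNReal.ofReal (|g z.1 z.2| ^ 2 / z.1 ^ (n + 1)) := by fun_prop
  have hc : MeasurableSet (cone α x) := (isOpen_cone x).measurableSet
  rw [sqMeasure, withDensity_apply _ hc, ← lintegral_indicator hc,
    lintegral_prod _ (hF.indicator hc).aemeasurable]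
  rfl

lemma tentNorm_eq {n : ℕ} {g : ℝ → En n → ℝ} (hg : Measurable (Function.uncurry g)) (p α : ℝ) :
    tentNorm n p α g = (∫⁻ x : En n, sqMeasure n g (cone α x) ^ (p / 2)) ^ (1 / p) := by
  simp_rw [tentNorm, conicalSq_eq hg, ← ENNReal.rpow_mul, one_div_mul_eq_div]

/-- For `σ = max(p,2)` there is `C = C(n,p) > 0` such that for all `α ≥ 1`,
`‖g‖_{T^{p,2}_1} ≤ C α^{-n/σ} ‖g‖_{T^{p,2}_α}`. -/
theorem statement4 (n : ℕ) (hn : 1 ≤ n) (p : ℝ) (hp : 0 < p) :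
    ∃ C : ℝ, 0 < C ∧ ∀ α : ℝ, 1 ≤ α → ∀ g : ℝ → En n → ℝ, LocSqInt n g →
      tentNorm n p 1 g ≤
        ENNReal.ofReal (C * α ^ (-(n : ℝ) / max p 2)) * tentNorm n p α g := by
  obtain ⟨C, hC, H⟩ := exists_lintegral_cone_rpow_le hn (half_pos hp)
  refine ⟨C ^ (1 / p), by positivity, fun α hα g hg => ?_⟩
  have hα0 : 0 < α := by linarith
  have hp' : 0 ≤ 1 / p := by positivity
  have hexp : -(n : ℝ) * min 1 (p / 2) * (1 / p) = -(n : ℝ) / max p 2 := by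
    rcases le_total p 2 with h | h
    · rw [max_eq_right h, min_eq_right (by linarith)]
      field_simp
    · rw [max_eq_left h, min_eq_left (by linarith)]
      field_simp
  rw [tentNorm_eq hg.1, tentNorm_eq hg.1, ← hexp, Real.rpow_mul hα0.le,
    ← Real.mul_rpow hC.le (by positivity), ← ENNReal.ofReal_rpow_of_pos (by positivity),
    ← ENNReal.mul_rpow_of_nonneg _ _ hp']
  exact ENNReal.rpow_le_rpow (H α hα _) hp'

end
end

section
/- Let n ≥ 1 and 2 ≤ p < ∞. There is a constant C > 0 depending only on n and p such that for every locally square integrable function g on (0,∞)×ℝⁿ, ‖g‖_{T^{p,2}_1} ≤ C ‖Vg‖_{L^p(ℝⁿ)}. -/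
open MeasureTheory Metric Set Filter ENNReal

noncomputable section

section Maximal

open Module

variable {E : Type*} [NormedAddCommGroup E] [NormedSpace ℝ E] [FiniteDimensional ℝ E]
  [MeasurableSpace E] (μ : Measure E) [μ.IsAddHaarMeasure]

/-- The centred Hardy-Littlewood maximal function over balls of dyadic radii. -/
def dyadicMaximal (h : E → ℝ≥0∞) (y : E) : ℝ≥0∞ :=
  ⨆ k : ℤ, ⨍⁻ x in closedBall y ((2 : ℝ) ^ k), h x ∂μ

variable {μ}

theorem setLIntegral_closedBall_le_dyadicMaximal (h : E → ℝ≥0∞) (y : E) (k : ℤ) :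
    ∫⁻ x in closedBall y ((2 : ℝ) ^ k), h x ∂μ ≤
      μ (closedBall y ((2 : ℝ) ^ k)) * dyadicMaximal μ h y := by
  rw [← measure_mul_setLAverage h measure_closedBall_lt_top.ne]
  gcongr
  exact le_iSup (fun k : ℤ => ⨍⁻ x in closedBall y ((2 : ℝ) ^ k), h x ∂μ) k

theorem dyadicMaximal_le_of_le_add {h f : E → ℝ≥0∞} (hf : Measurable f) {c : ℝ≥0∞}
    (hle : ∀ x, h x ≤ f x + c) (y : E) : dyadicMaximal μ h y ≤ dyadicMaximal μ f y + c := by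
  refine iSup_le fun k => ?_
  have h0 : μ (closedBall y ((2 : ℝ) ^ k)) ≠ 0 :=
    (measure_closedBall_pos μ y (by positivity)).ne'
  have h1 : μ (closedBall y ((2 : ℝ) ^ k)) ≠ ∞ := measure_closedBall_lt_top.ne
  calc ⨍⁻ x in closedBall y ((2 : ℝ) ^ k), h x ∂μ
      ≤ ⨍⁻ x in closedBall y ((2 : ℝ) ^ k), (f x + c) ∂μ := by
        rw [setLAverage_eq, setLAverage_eq]
        gcongr with x
        exact hle x
    _ = (⨍⁻ x in closedBall y ((2 : ℝ) ^ k), f x ∂μ) + c := by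
        rw [setLAverage_eq, setLAverage_eq, lintegral_add_left hf, ENNReal.add_div,
          setLIntegral_const, ENNReal.mul_div_cancel_right h0 h1]
    _ ≤ _ := by
        gcongr
        exact le_iSup (fun k : ℤ => ⨍⁻ x in closedBall y ((2 : ℝ) ^ k), f x ∂μ) k

theorem dyadicMaximal_le_const {h : E → ℝ≥0∞} {c : ℝ≥0∞} (hle : ∀ x, h x ≤ c) (y : E) :
    dyadicMaximal μ h y ≤ c := by
  have := dyadicMaximal_le_of_le_add (μ := μ) (h := h) (f := fun _ => 0) measurable_const
    (by simpa using hle) y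
  simpa [dyadicMaximal, setLAverage_eq] using this

variable [BorelSpace E]

theorem measurable_dyadicMaximal {h : E → ℝ≥0∞} (hh : Measurable h) :
    Measurable (dyadicMaximal μ h) := by
  refine Measurable.iSup fun k => ?_
  have hset : MeasurableSet {z : E × E | dist z.2 z.1 ≤ (2 : ℝ) ^ k} :=
    (isClosed_le (by fun_prop) continuous_const).measurableSet
  have hint : Measurable fun y => ∫⁻ x, indicator {z : E × E | dist z.2 z.1 ≤ (2 : ℝ) ^ k}
      (fun z => h z.2) (y, x) ∂μ :=
    Measurable.lintegral_prod_right' ((hh.comp measurable_snd).indicator hset)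
  have heq : ∀ y, ∫⁻ x in closedBall y ((2 : ℝ) ^ k), h x ∂μ =
      ∫⁻ x, indicator {z : E × E | dist z.2 z.1 ≤ (2 : ℝ) ^ k} (fun z => h z.2) (y, x) ∂μ := by
    intro y
    rw [← lintegral_indicator measurableSet_closedBall]
    rfl
  simp_rw [setLAverage_eq, heq, Measure.addHaar_closedBall_center]
  exact hint.div_const _

theorem setLIntegral_ball_le_dyadicMaximal (h : E → ℝ≥0∞) (y : E) {t : ℝ} (ht : 0 < t) :
    ∫⁻ x in ball y t, h x ∂μ ≤
      ENNReal.ofReal (2 ^ finrank ℝ E) * μ (ball 0 1) * ENNReal.ofReal (t ^ finrank ℝ E) *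
        dyadicMaximal μ h y := by
  obtain ⟨k, hk, hk'⟩ := exists_mem_Ioc_zpow ht (one_lt_two (α := ℝ))
  calc ∫⁻ x in ball y t, h x ∂μ
      ≤ ∫⁻ x in closedBall y ((2 : ℝ) ^ (k + 1)), h x ∂μ :=
        lintegral_mono_set (ball_subset_closedBall.trans (closedBall_subset_closedBall hk'))
    _ ≤ _ := setLIntegral_closedBall_le_dyadicMaximal h y (k + 1)
    _ ≤ μ (closedBall y (2 * t)) * dyadicMaximal μ h y := by
        gcongr
        rw [zpow_add_one₀ two_ne_zero]
        linarith
    _ = _ := by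
        rw [Measure.addHaar_closedBall μ y (by positivity), mul_pow,
          ENNReal.ofReal_mul (by positivity)]
        ring

/-- The weak type `(1, 1)` bound for the dyadic maximal function. -/
theorem mul_measure_lt_dyadicMaximal_le [Nontrivial E] (h : E → ℝ≥0∞) {c : ℝ≥0∞} (hc : c ≠ ∞) :
    c * μ {y | c < dyadicMaximal μ h y} ≤
      ENNReal.ofReal (5 ^ finrank ℝ E) * ∫⁻ x, h x ∂μ := by
  rcases eq_or_ne c 0 with rfl | hc0
  · simp
  have hK : ENNReal.ofReal (5 ^ finrank ℝ E) ≠ 0 := by simp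
  rcases eq_or_ne (∫⁻ x, h x ∂μ) ∞ with htop | hfin
  · rw [htop, ENNReal.mul_top hK]
    exact le_top
  set S := {y | c < dyadicMaximal μ h y} with hS
  have hsel : ∀ y ∈ S, ∃ k : ℤ, c * μ (closedBall y ((2 : ℝ) ^ k)) ≤
      ∫⁻ x in closedBall y ((2 : ℝ) ^ k), h x ∂μ := by
    intro y hy
    obtain ⟨k, hk⟩ := lt_iSup_iff.1 (show c < dyadicMaximal μ h y from hy)
    refine ⟨k, ?_⟩
    rw [← measure_mul_setLAverage h measure_closedBall_lt_top.ne, mul_comm]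
    gcongr
  choose! k hk using hsel
  have hv0 : μ (ball (0 : E) 1) ≠ 0 := (measure_ball_pos μ 0 one_pos).ne'
  have hv1 : μ (ball (0 : E) 1) ≠ ∞ := measure_ball_lt_top.ne
  set A : ℝ≥0∞ := (∫⁻ x, h x ∂μ) / (c * μ (ball (0 : E) 1)) with hA
  have hAtop : A ≠ ∞ := ENNReal.div_ne_top hfin (mul_ne_zero hc0 hv0)
  have hR : ∀ y ∈ S, (2 : ℝ) ^ k y ≤ max 1 A.toReal := by
    intro y hy
    by_contra! hcon
    obtain ⟨h1, h2⟩ := max_lt_iff.1 hcon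
    have h3 : ENNReal.ofReal (((2 : ℝ) ^ k y) ^ finrank ℝ E) ≤ A := by
      rw [hA, ENNReal.le_div_iff_mul_le (Or.inl (mul_ne_zero hc0 hv0))
        (Or.inl (ENNReal.mul_ne_top hc hv1))]
      calc _ = c * μ (closedBall y ((2 : ℝ) ^ k y)) := by
            rw [Measure.addHaar_closedBall μ y (by positivity)]
            ring
        _ ≤ _ := (hk y hy).trans (setLIntegral_le_lintegral _ _)
    have h4 := ENNReal.toReal_mono hAtop h3
    rw [ENNReal.toReal_ofReal (by positivity)] at h4
    have h5 : (2 : ℝ) ^ k y ≤ ((2 : ℝ) ^ k y) ^ finrank ℝ E :=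
      le_self_pow₀ h1.le finrank_pos.ne'
    linarith
  obtain ⟨u, huS, hdisj, hcov⟩ := Vitali.exists_disjoint_subfamily_covering_enlargement_closedBall
    S id (fun y => (2 : ℝ) ^ k y) _ hR 5 (by norm_num)
  simp only [id] at hdisj hcov
  have hucount : u.Countable := hdisj.countable_of_nonempty_interior fun y _ =>
    (nonempty_ball.2 (by positivity)).mono ball_subset_interior_closedBall
  have hSsub : S ⊆ ⋃ y ∈ u, closedBall y (5 * (2 : ℝ) ^ k y) := by
    intro y hy
    obtain ⟨z, hz, hsub⟩ := hcov y hy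
    exact mem_iUnion₂.2 ⟨z, hz, hsub (mem_closedBall_self (by positivity))⟩
  have : Countable u := hucount
  calc c * μ S ≤ c * ∑' y : u, μ (closedBall (y : E) (5 * (2 : ℝ) ^ k y)) := by
        gcongr
        exact (measure_mono hSsub).trans (measure_biUnion_le μ hucount _)
    _ = ENNReal.ofReal (5 ^ finrank ℝ E) *
          ∑' y : u, c * μ (closedBall (y : E) ((2 : ℝ) ^ k y)) := by
        rw [← ENNReal.tsum_mul_left, ← ENNReal.tsum_mul_left]
        congr with y
        rw [Measure.addHaar_closedBall_mul μ _ (by norm_num) (by positivity),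
          Measure.addHaar_closedBall_center μ (y : E)]
        ring
    _ ≤ ENNReal.ofReal (5 ^ finrank ℝ E) *
          ∑' y : u, ∫⁻ x in closedBall (y : E) ((2 : ℝ) ^ k y), h x ∂μ := by
        gcongr with y
        exact hk y (huS y.2)
    _ = ENNReal.ofReal (5 ^ finrank ℝ E) *
          ∫⁻ x in ⋃ y ∈ u, closedBall (y : E) ((2 : ℝ) ^ k y), h x ∂μ := by
        rw [lintegral_biUnion hucount (fun _ _ => measurableSet_closedBall) hdisj]
    _ ≤ _ := mul_le_mul_right (setLIntegral_le_lintegral _ _) _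

theorem mul_measure_lt_dyadicMaximal_le_setLIntegral [Nontrivial E] {h : E → ℝ≥0∞}
    (hh : Measurable h) {c : ℝ≥0∞} (hc : c ≠ ∞) :
    c * μ {y | c < dyadicMaximal μ h y} ≤
      2 * ENNReal.ofReal (5 ^ finrank ℝ E) * ∫⁻ x in {x | c < 2 * h x}, h x ∂μ := by
  have hset : MeasurableSet {x | c < 2 * h x} := measurableSet_lt measurable_const (hh.const_mul 2)
  set f := indicator {x | c < 2 * h x} h with hf
  have hle : ∀ x, h x ≤ f x + c / 2 := by
    intro x
    by_cases hx : c < 2 * h x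
    · rw [hf, indicator_of_mem (by exact hx)]
      exact le_self_add
    · rw [hf, indicator_of_notMem (by exact hx), zero_add,
        ENNReal.le_div_iff_mul_le (by simp) (by simp), mul_comm]
      exact not_lt.1 hx
  have hsub : {y | c < dyadicMaximal μ h y} ⊆ {y | c / 2 < dyadicMaximal μ f y} := by
    intro y hy
    by_contra hcon
    refine absurd (show c < dyadicMaximal μ h y from hy) (not_lt.2 ?_)
    calc dyadicMaximal μ h y ≤ dyadicMaximal μ f y + c / 2 :=
          dyadicMaximal_le_of_le_add (hh.indicator hset) hle y
      _ ≤ c / 2 + c / 2 := by gcongr; exact not_lt.1 hcon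
      _ = c := ENNReal.add_halves c
  calc c * μ {y | c < dyadicMaximal μ h y}
      = 2 * (c / 2 * μ {y | c < dyadicMaximal μ h y}) := by
        rw [← mul_assoc, ENNReal.mul_div_cancel (a := 2) two_ne_zero (by simp)]
    _ ≤ 2 * (c / 2 * μ {y | c / 2 < dyadicMaximal μ f y}) := by gcongr
    _ ≤ 2 * (ENNReal.ofReal (5 ^ finrank ℝ E) * ∫⁻ x, f x ∂μ) := by
        exact mul_le_mul_right
          (mul_measure_lt_dyadicMaximal_le f (ENNReal.div_ne_top hc two_ne_zero)) _
    _ = _ := by rw [hf, lintegral_indicator hset, mul_assoc]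

theorem lintegral_rpow_eq_lintegral_measure_ofReal_lt {α : Type*} [MeasurableSpace α]
    (ν : Measure α) {f : α → ℝ≥0∞} (hf : Measurable f) (hfin : ∀ x, f x ≠ ∞) {p : ℝ}
    (hp : 0 < p) :
    ∫⁻ x, f x ^ p ∂ν = ENNReal.ofReal p *
      ∫⁻ t in Ioi (0 : ℝ), ν {x | ENNReal.ofReal t < f x} * ENNReal.ofReal (t ^ (p - 1)) := by
  have key := lintegral_rpow_eq_lintegral_meas_lt_mul ν (f := fun x => (f x).toReal)
    (Eventually.of_forall fun _ => ENNReal.toReal_nonneg) hf.ennreal_toReal.aemeasurable hp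
  convert key using 1
  · refine lintegral_congr fun x => ?_
    rw [← ENNReal.ofReal_rpow_of_nonneg ENNReal.toReal_nonneg hp.le, ENNReal.ofReal_toReal (hfin x)]
  · congr 1
    refine setLIntegral_congr_fun measurableSet_Ioi fun t ht => ?_
    simp only [ENNReal.ofReal_lt_iff_lt_toReal (le_of_lt (mem_Ioi.1 ht)) (hfin _)]

/-- The strong type `(s, s)` bound for the dyadic maximal function on bounded functions. -/
theorem exists_lintegral_dyadicMaximal_rpow_le [Nontrivial E] {s : ℝ} (hs : 1 < s) :
    ∃ C : ℝ≥0∞, C ≠ ∞ ∧ ∀ h : E → ℝ≥0∞, Measurable h → ∀ N : ℝ≥0∞, N ≠ ∞ → (∀ x, h x ≤ N) →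
      ∫⁻ y, dyadicMaximal μ h y ^ s ∂μ ≤ C * ∫⁻ x, h x ^ s ∂μ := by
  have hs1 : 0 < s - 1 := by linarith
  set K : ℝ≥0∞ := 2 * ENNReal.ofReal (5 ^ finrank ℝ E) with hK
  have hK_top : K ≠ ∞ := ENNReal.mul_ne_top (by simp) ENNReal.ofReal_ne_top
  have hs1' : ENNReal.ofReal (s - 1) ≠ 0 := by simpa using hs
  refine ⟨ENNReal.ofReal s * K * (ENNReal.ofReal (s - 1))⁻¹ * 2 ^ (s - 1), ?_, ?_⟩
  · refine ENNReal.mul_ne_top (ENNReal.mul_ne_top (ENNReal.mul_ne_top ENNReal.ofReal_ne_top hK_top)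
      (ENNReal.inv_ne_top.2 hs1')) (ENNReal.rpow_ne_top_of_nonneg hs1.le (by simp))
  intro h hh N hN hle
  have hfin : ∀ x, h x ≠ ∞ := fun x => ((hle x).trans_lt hN.lt_top).ne
  have hMfin : ∀ x, dyadicMaximal μ h x ≠ ∞ :=
    fun x => ((dyadicMaximal_le_const hle x).trans_lt hN.lt_top).ne
  set ν := μ.withDensity h with hν
  have hlayer := lintegral_rpow_eq_lintegral_measure_ofReal_lt ν (hh.const_mul 2)
    (fun x => ENNReal.mul_ne_top (by simp) (hfin x)) hs1
  calc ∫⁻ y, dyadicMaximal μ h y ^ s ∂μ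
      = ENNReal.ofReal s * ∫⁻ t in Ioi (0 : ℝ),
          μ {x | ENNReal.ofReal t < dyadicMaximal μ h x} * ENNReal.ofReal (t ^ (s - 1)) :=
        lintegral_rpow_eq_lintegral_measure_ofReal_lt μ (measurable_dyadicMaximal hh) hMfin
          (by linarith)
    _ ≤ ENNReal.ofReal s * ∫⁻ t in Ioi (0 : ℝ),
          K * (ν {x | ENNReal.ofReal t < 2 * h x} * ENNReal.ofReal (t ^ (s - 1 - 1))) := by
        refine mul_le_mul_right (setLIntegral_mono' measurableSet_Ioi fun t ht => ?_) _
        have ht' : (0 : ℝ) < t := ht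
        have hpow : t ^ (s - 1) = t * t ^ (s - 1 - 1) := by
          rw [Real.rpow_sub_one ht'.ne' (s - 1)]
          field_simp
        rw [hpow, ENNReal.ofReal_mul ht'.le, ← mul_assoc, ← mul_assoc, mul_comm (μ _)]
        refine mul_le_mul_left ?_ _
        rw [hν, withDensity_apply _ (measurableSet_lt measurable_const (hh.const_mul 2))]
        exact mul_measure_lt_dyadicMaximal_le_setLIntegral hh ENNReal.ofReal_ne_top
    _ = ENNReal.ofReal s * K * (ENNReal.ofReal (s - 1))⁻¹ * ∫⁻ x, (2 * h x) ^ (s - 1) ∂ν := by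
        rw [lintegral_const_mul' _ _ hK_top, hlayer, mul_assoc _ (ENNReal.ofReal (s - 1))⁻¹,
          ENNReal.inv_mul_cancel_left hs1' ENNReal.ofReal_ne_top, ← mul_assoc]
    _ = _ := by
        rw [hν, lintegral_withDensity_eq_lintegral_mul _ hh (by fun_prop), mul_assoc _ (2 ^ (s - 1)),
          ← lintegral_const_mul (2 ^ (s - 1)) (by fun_prop)]
        refine congrArg _ (lintegral_congr fun x => ?_)
        rw [Pi.mul_apply, ENNReal.mul_rpow_of_nonneg _ _ hs1.le, mul_left_comm]
        congr 1
        rcases eq_or_ne (h x) 0 with h0 | h0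
        · simp [h0, ENNReal.zero_rpow_of_pos (zero_lt_one.trans hs)]
        · rw [ENNReal.rpow_sub _ _ h0 (hfin x), ENNReal.rpow_one,
            ENNReal.mul_div_cancel h0 (hfin x)]

/-- Duality between the integral over cones and the maximal function. -/
theorem lintegral_cone_mul_le {G : ℝ → E → ℝ≥0∞} (hG : Measurable (Function.uncurry G))
    {h : E → ℝ≥0∞} (hh : Measurable h) :
    ∫⁻ x, (∫⁻ t in Ioi (0 : ℝ), ∫⁻ y, (ball x t).indicator (G t) y ∂μ) * h x ∂μ ≤
      ENNReal.ofReal (2 ^ finrank ℝ E) * μ (ball 0 1) *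
        ∫⁻ y, (∫⁻ t in Ioi (0 : ℝ), G t y * ENNReal.ofReal (t ^ finrank ℝ E)) *
          dyadicMaximal μ h y ∂μ := by
  set K := ENNReal.ofReal (2 ^ finrank ℝ E) * μ (ball (0 : E) 1) with hK
  have hK_top : K ≠ ∞ := ENNReal.mul_ne_top ENNReal.ofReal_ne_top measure_ball_lt_top.ne
  set S : Set (E × ℝ × E) := {z | dist z.2.2 z.1 < z.2.1} with hS
  have hSm : MeasurableSet S := (isOpen_lt (by fun_prop) (by fun_prop)).measurableSet
  set Ψ : E × ℝ × E → ℝ≥0∞ := S.indicator fun z => G z.2.1 z.2.2 * h z.1 with hΨ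
  have hΨm : Measurable Ψ :=
    ((hG.comp measurable_snd).mul (hh.comp measurable_fst)).indicator hSm
  have hind : ∀ x t y, (ball x t).indicator (G t) y * h x = Ψ (x, t, y) := by
    intro x t y
    by_cases hy : dist y x < t
    · rw [hΨ, indicator_of_mem (show y ∈ ball x t from hy),
        indicator_of_mem (show (x, t, y) ∈ S from hy)]
    · rw [hΨ, indicator_of_notMem (show y ∉ ball x t from hy),
        indicator_of_notMem (show (x, t, y) ∉ S from hy), zero_mul]
  have hGt : ∀ t, Measurable (G t) := fun t => hG.comp measurable_prodMk_left
  have hMm := measurable_dyadicMaximal (μ := μ) hh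
  have hinner : ∀ x t, (∫⁻ y, (ball x t).indicator (G t) y ∂μ) * h x =
      ∫⁻ y, Ψ (x, t, y) ∂μ := by
    intro x t
    rw [← lintegral_mul_const _ ((hGt t).indicator measurableSet_ball)]
    exact lintegral_congr fun y => hind x t y
  have hcone : ∀ x, Measurable fun t => ∫⁻ y, (ball x t).indicator (G t) y ∂μ := by
    intro x
    have hset : MeasurableSet {z : ℝ × E | dist z.2 x < z.1} :=
      (isOpen_lt (by fun_prop) (by fun_prop)).measurableSet
    exact Measurable.lintegral_prod_right' (f := {z : ℝ × E | dist z.2 x < z.1}.indicator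
      (Function.uncurry G)) (hG.indicator hset)
  have hfiber : ∀ t ∈ Ioi (0 : ℝ), ∀ y, ∫⁻ x, Ψ (x, t, y) ∂μ ≤
      K * (G t y * ENNReal.ofReal (t ^ finrank ℝ E) * dyadicMaximal μ h y) := by
    intro t ht y
    calc ∫⁻ x, Ψ (x, t, y) ∂μ = ∫⁻ x, G t y * (ball y t).indicator h x ∂μ := by
          refine lintegral_congr fun x => ?_
          rw [← hind]
          by_cases hx : dist y x < t
          · rw [indicator_of_mem (show y ∈ ball x t from hx),
              indicator_of_mem (mem_ball_comm.1 (show y ∈ ball x t from hx))]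
          · rw [indicator_of_notMem (show y ∉ ball x t from hx),
              indicator_of_notMem (mem_ball_comm.not.1 (show y ∉ ball x t from hx)), zero_mul,
              mul_zero]
    _ = G t y * ∫⁻ x in ball y t, h x ∂μ := by
          rw [lintegral_const_mul _ (hh.indicator measurableSet_ball),
            lintegral_indicator measurableSet_ball]
    _ ≤ G t y * (K * ENNReal.ofReal (t ^ finrank ℝ E) * dyadicMaximal μ h y) := by
          gcongr
          exact setLIntegral_ball_le_dyadicMaximal h y ht
    _ = _ := by ring
  have hpow : Measurable fun t : ℝ => ENNReal.ofReal (t ^ finrank ℝ E) := by fun_prop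
  have hGpow : ∀ y, Measurable fun t => G t y * ENNReal.ofReal (t ^ finrank ℝ E) :=
    fun y => (hG.comp measurable_prodMk_right).mul hpow
  calc ∫⁻ x, (∫⁻ t in Ioi (0 : ℝ), ∫⁻ y, (ball x t).indicator (G t) y ∂μ) * h x ∂μ
      = ∫⁻ x, (∫⁻ t in Ioi (0 : ℝ), ∫⁻ y, Ψ (x, t, y) ∂μ) ∂μ := by
        refine lintegral_congr fun x => ?_
        rw [← lintegral_mul_const _ (hcone x)]
        exact lintegral_congr fun t => hinner x t
    _ = ∫⁻ t in Ioi (0 : ℝ), ∫⁻ x, ∫⁻ y, Ψ (x, t, y) ∂μ ∂μ := by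
        refine lintegral_lintegral_swap (Measurable.aemeasurable ?_)
        exact Measurable.lintegral_prod_right' (f := fun z : (E × ℝ) × E => Ψ (z.1.1, z.1.2, z.2))
          (hΨm.comp (by fun_prop))
    _ = ∫⁻ t in Ioi (0 : ℝ), ∫⁻ y, ∫⁻ x, Ψ (x, t, y) ∂μ ∂μ := by
        refine lintegral_congr fun t => lintegral_lintegral_swap (Measurable.aemeasurable ?_)
        exact hΨm.comp (g := Ψ) (f := fun z : E × E => (z.1, t, z.2)) (by fun_prop)
    _ ≤ ∫⁻ t in Ioi (0 : ℝ), ∫⁻ y,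
          K * (G t y * ENNReal.ofReal (t ^ finrank ℝ E) * dyadicMaximal μ h y) ∂μ :=
        setLIntegral_mono' measurableSet_Ioi fun t ht => lintegral_mono (hfiber t ht)
    _ = ∫⁻ y, (∫⁻ t in Ioi (0 : ℝ),
          K * (G t y * ENNReal.ofReal (t ^ finrank ℝ E) * dyadicMaximal μ h y)) ∂μ := by
        refine lintegral_lintegral_swap (Measurable.aemeasurable ?_)
        exact ((hG.mul (hpow.comp measurable_fst)).mul (hMm.comp measurable_snd)).const_mul K
    _ = _ := by
        rw [← lintegral_const_mul' _ _ hK_top]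
        refine lintegral_congr fun y => ?_
        rw [lintegral_const_mul' _ _ hK_top, lintegral_mul_const _ (hGpow y)]

theorem measurable_lintegral_cone {G : ℝ → E → ℝ≥0∞} (hG : Measurable (Function.uncurry G)) :
    Measurable fun x => ∫⁻ t in Ioi (0 : ℝ), ∫⁻ y, (ball x t).indicator (G t) y ∂μ := by
  have hset : MeasurableSet {z : (E × ℝ) × E | dist z.2 z.1.1 < z.1.2} :=
    (isOpen_lt (by fun_prop) (by fun_prop)).measurableSet
  have hf : Measurable fun z : (E × ℝ) × E => Function.uncurry G (z.1.2, z.2) :=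
    hG.comp (by fun_prop)
  have h1 : Measurable fun w : E × ℝ => ∫⁻ y, (ball w.1 w.2).indicator (G w.2) y ∂μ :=
    Measurable.lintegral_prod_right' (hf.indicator hset)
  exact Measurable.lintegral_prod_right' h1

theorem lintegral_rpow_le_of_forall_truncation_le {α : Type*} [PseudoMetricSpace α]
    [MeasurableSpace α] [OpensMeasurableSpace α] {ν : Measure α} {F : α → ℝ≥0∞} (hF : Measurable F)
    (a : α) {q : ℝ} {B : ℝ≥0∞}
    (hB : ∀ N : ℕ, ∫⁻ x, (ball a N).indicator (fun x => min (F x) N ^ q) x ∂ν ≤ B) :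
    ∫⁻ x, F x ^ q ∂ν ≤ B := by
  have hlim : ∀ x, Tendsto
      (fun N : ℕ => (ball a N).indicator (fun x => min (F x) N ^ q) x) atTop
      (nhds (F x ^ q)) := by
    intro x
    have h1 : Tendsto (fun N : ℕ => min (F x) N) atTop (nhds (F x)) := by
      simpa using (tendsto_const_nhds (x := F x)).min ENNReal.tendsto_nat_nhds_top
    refine ((ENNReal.continuous_rpow_const (y := q)).tendsto _ |>.comp h1).congr' ?_
    filter_upwards [tendsto_natCast_atTop_atTop.eventually_gt_atTop (dist x a)] with N hN
    rw [indicator_of_mem (show x ∈ ball a N from hN)]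
    rfl
  calc ∫⁻ x, F x ^ q ∂ν
      = ∫⁻ x, liminf (fun N : ℕ =>
          (ball a N).indicator (fun x => min (F x) N ^ q) x) atTop ∂ν :=
        lintegral_congr fun x => (hlim x).liminf_eq.symm
    _ ≤ liminf (fun N : ℕ =>
          ∫⁻ x, (ball a N).indicator (fun x => min (F x) N ^ q) x ∂ν) atTop :=
        lintegral_liminf_le fun N =>
          ((hF.min measurable_const).pow_const q).indicator measurableSet_ball
    _ ≤ B := by
        refine (liminf_le_liminf (Eventually.of_forall hB)).trans ?_
        simp

theorem le_rpow_mul_of_le_mul_rpow {q s : ℝ} (hqs : q.HolderConjugate s) {X Y D : ℝ≥0∞}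
    (hX : X ≠ ∞) (h : X ≤ D * Y ^ (1 / q) * X ^ (1 / s)) : X ≤ D ^ q * Y := by
  have hq := hqs.pos
  have hs := hqs.symm.pos
  rcases eq_or_ne X 0 with rfl | hX0
  · exact zero_le
  have h1 : X ^ (1 / q) * X ^ (1 / s) ≤ D * Y ^ (1 / q) * X ^ (1 / s) := by
    rw [← ENNReal.rpow_add _ _ hX0 hX, one_div, one_div, hqs.inv_add_inv_eq_one, ENNReal.rpow_one,
      ← one_div, ← one_div]
    exact h
  have h2 : X ^ (1 / q) ≤ D * Y ^ (1 / q) := by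
    refine (ENNReal.mul_le_mul_iff_left ?_ ?_).1 h1
    · exact (ENNReal.rpow_pos (pos_iff_ne_zero.2 hX0) hX).ne'
    · exact ENNReal.rpow_ne_top_of_nonneg (by positivity) hX
  have h3 := ENNReal.rpow_le_rpow h2 hq.le
  rwa [ENNReal.mul_rpow_of_nonneg _ _ hq.le, ← ENNReal.rpow_mul, ← ENNReal.rpow_mul,
    one_div_mul_cancel hq.ne', ENNReal.rpow_one, ENNReal.rpow_one] at h3

variable (μ) in
theorem exists_lintegral_cone_rpow_le_s10 [Nontrivial E] {q : ℝ} (hq : 1 ≤ q) :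
    ∃ C : ℝ≥0∞, C ≠ ∞ ∧ ∀ G : ℝ → E → ℝ≥0∞, Measurable (Function.uncurry G) →
      ∫⁻ x, (∫⁻ t in Ioi (0 : ℝ), ∫⁻ y, (ball x t).indicator (G t) y ∂μ) ^ q ∂μ ≤
        C * ∫⁻ y, (∫⁻ t in Ioi (0 : ℝ), G t y * ENNReal.ofReal (t ^ finrank ℝ E)) ^ q ∂μ := by
  set K := ENNReal.ofReal (2 ^ finrank ℝ E) * μ (ball (0 : E) 1) with hK
  have hK_top : K ≠ ∞ := ENNReal.mul_ne_top ENNReal.ofReal_ne_top measure_ball_lt_top.ne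
  rcases hq.eq_or_lt with rfl | hq
  · refine ⟨K, hK_top, fun G hG => ?_⟩
    have h1 := lintegral_cone_mul_le (μ := μ) hG (h := fun _ => 1) measurable_const
    simp only [mul_one] at h1
    simp only [ENNReal.rpow_one]
    refine h1.trans (mul_le_mul_right (lintegral_mono fun y => ?_) _)
    exact mul_le_of_le_one_right' (dyadicMaximal_le_const (fun _ => le_rfl) y)
  have hq0 : 0 < q := by linarith
  set s := q.conjExponent with hs_def
  have hqs : q.HolderConjugate s := Real.HolderConjugate.conjExponent hq
  have hs : 0 < s := hqs.symm.pos
  obtain ⟨C, hC, hmax⟩ := exists_lintegral_dyadicMaximal_rpow_le (μ := μ) hqs.symm.lt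
  refine ⟨(K * C ^ (1 / s)) ^ q, ENNReal.rpow_ne_top_of_nonneg hq0.le
    (ENNReal.mul_ne_top hK_top (ENNReal.rpow_ne_top_of_nonneg (by positivity) hC)), fun G hG => ?_⟩
  set F : E → ℝ≥0∞ := fun x => ∫⁻ t in Ioi (0 : ℝ), ∫⁻ y, (ball x t).indicator (G t) y ∂μ with hF_def
  have hF : Measurable F := measurable_lintegral_cone hG
  set V : E → ℝ≥0∞ := fun y => ∫⁻ t in Ioi (0 : ℝ), G t y * ENNReal.ofReal (t ^ finrank ℝ E) with hV
  have hVm : Measurable V := by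
    refine Measurable.lintegral_prod_left' (f := fun z : ℝ × E =>
      Function.uncurry G z * ENNReal.ofReal (z.1 ^ finrank ℝ E)) ?_
    fun_prop
  refine lintegral_rpow_le_of_forall_truncation_le hF 0 fun N => ?_
  set h : E → ℝ≥0∞ := (ball (0 : E) N).indicator fun x => min (F x) N ^ (q - 1) with hh_def
  have hh : Measurable h :=
    ((hF.min measurable_const).pow_const (q - 1)).indicator measurableSet_ball
  set X := ∫⁻ x, (ball (0 : E) N).indicator (fun x => min (F x) N ^ q) x ∂μ with hX_def
  have hXtop : X ≠ ∞ := by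
    rw [hX_def, lintegral_indicator measurableSet_ball]
    refine (setLIntegral_lt_top_of_le_nnreal measure_ball_lt_top.ne
      ⟨(N : NNReal) ^ q, fun x _ => ?_⟩).ne
    rw [ENNReal.coe_rpow_of_nonneg _ hq0.le, ENNReal.coe_natCast]
    exact ENNReal.rpow_le_rpow (min_le_right _ _) hq0.le
  have hpow : ∀ x, h x ^ s = (ball (0 : E) N).indicator (fun x => min (F x) N ^ q) x := by
    intro x
    by_cases hx : x ∈ ball (0 : E) N
    · rw [hh_def, indicator_of_mem hx, indicator_of_mem hx, ← ENNReal.rpow_mul,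
        hqs.sub_one_mul_conj]
    · rw [hh_def, indicator_of_notMem hx, indicator_of_notMem hx, ENNReal.zero_rpow_of_pos hs]
  have hbound : ∀ x, h x ≤ (N : ℝ≥0∞) ^ (q - 1) := fun x =>
    indicator_le' (fun x _ => ENNReal.rpow_le_rpow (min_le_right _ _) (by linarith))
      (fun _ _ => zero_le) x
  have hXle : X ≤ ∫⁻ x, F x * h x ∂μ := by
    refine lintegral_mono fun x => ?_
    by_cases hx : x ∈ ball (0 : E) N
    · simp only [hh_def, indicator_of_mem hx]
      calc min (F x) N ^ q = min (F x) N ^ (1 + (q - 1)) := by ring_nf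
        _ = min (F x) N * min (F x) N ^ (q - 1) := by
          rw [ENNReal.rpow_add_of_nonneg _ _ zero_le_one (by linarith), ENNReal.rpow_one]
        _ ≤ _ := by gcongr; exact min_le_left _ _
    · simp [hh_def, indicator_of_notMem hx]
  refine le_rpow_mul_of_le_mul_rpow hqs hXtop ?_
  calc X ≤ ∫⁻ x, F x * h x ∂μ := hXle
    _ ≤ K * ∫⁻ y, V y * dyadicMaximal μ h y ∂μ := lintegral_cone_mul_le hG hh
    _ ≤ K * ((∫⁻ y, V y ^ q ∂μ) ^ (1 / q) *
          (∫⁻ y, dyadicMaximal μ h y ^ s ∂μ) ^ (1 / s)) := by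
        gcongr
        exact ENNReal.lintegral_mul_le_Lp_mul_Lq μ hqs hVm.aemeasurable
          (measurable_dyadicMaximal hh).aemeasurable
    _ ≤ K * ((∫⁻ y, V y ^ q ∂μ) ^ (1 / q) * (C * X) ^ (1 / s)) := by
        gcongr
        refine (hmax h hh _ (ENNReal.rpow_ne_top_of_nonneg (by linarith) (by simp)) hbound).trans_eq ?_
        rw [hX_def, lintegral_congr hpow]
    _ = _ := by
        rw [ENNReal.mul_rpow_of_nonneg _ _ (by positivity : 0 ≤ 1 / s)]
        ring

end Maximal

/-- (Corollary, case `p ≥ 2`.) There is `C = C(n,p) > 0` such that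
`‖g‖_{T^{p,2}_1} ≤ C ‖Vg‖_p` for all locally square integrable `g`. -/
theorem statement10 (n : ℕ) (hn : 1 ≤ n) (p : ℝ) (hp2 : 2 ≤ p) :
    ∃ C : ℝ, 0 < C ∧ ∀ g : ℝ → En n → ℝ, LocSqInt n g →
      tentNorm n p 1 g ≤ ENNReal.ofReal C * vertNorm n p g := by
  have : Nonempty (Fin n) := ⟨⟨0, hn⟩⟩
  have hp : 0 < p := by linarith
  obtain ⟨C, hC, hcone⟩ :=
    exists_lintegral_cone_rpow_le_s10 (volume : Measure (En n)) (q := p / 2) (by linarith)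
  refine ⟨(C ^ (1 / p)).toReal + 1, by positivity, fun g hg => ?_⟩
  have hgm : Measurable fun z : ℝ × En n => g z.1 z.2 := hg.1
  have hC' : C ^ (1 / p) ≤ ENNReal.ofReal ((C ^ (1 / p)).toReal + 1) := by
    rw [← ENNReal.ofReal_toReal (ENNReal.rpow_ne_top_of_nonneg (by positivity) hC)]
    exact ENNReal.ofReal_le_ofReal (by simp)
  set G : ℝ → En n → ℝ≥0∞ := fun t y => ENNReal.ofReal (|g t y| ^ 2 / t ^ (n + 1)) with hG_def
  have hG : Measurable (Function.uncurry G) := by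
    change Measurable fun z : ℝ × En n => ENNReal.ofReal (|g z.1 z.2| ^ 2 / z.1 ^ (n + 1))
    simp only [sq_abs]
    fun_prop
  have hvert : ∀ y, vertSq n g y ^ p =
      (∫⁻ t in Ioi (0 : ℝ), G t y * ENNReal.ofReal (t ^ Module.finrank ℝ (En n))) ^ (p / 2) := by
    intro y
    rw [vertSq, ← ENNReal.rpow_mul, one_div_mul_eq_div, finrank_euclideanSpace_fin]
    congr 1
    refine setLIntegral_congr_fun measurableSet_Ioi fun t ht => ?_
    have ht' : (0 : ℝ) < t := ht
    simp only [hG_def]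
    rw [← ENNReal.ofReal_mul (by positivity), pow_succ]
    congr 1
    field_simp
    ring
  have hconical : ∀ x, conicalSq n 1 g x ^ p =
      (∫⁻ t in Ioi (0 : ℝ), ∫⁻ y, (ball x t).indicator (G t) y) ^ (p / 2) := by
    intro x
    rw [conicalSq, ← ENNReal.rpow_mul, one_div_mul_eq_div]
    simp only [one_mul]
    rfl
  calc tentNorm n p 1 g ≤ (C * ∫⁻ y, vertSq n g y ^ p) ^ (1 / p) := by
        simp only [tentNorm, hconical, hvert]
        exact ENNReal.rpow_le_rpow (hcone G hG) (by positivity)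
    _ = C ^ (1 / p) * vertNorm n p g := by
        rw [vertNorm, ENNReal.mul_rpow_of_nonneg _ _ (by positivity)]
    _ ≤ _ := by gcongr

end
end
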